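/- arXiv:2106.11235 — 2 statements merged into one kernel-verified Lean document; each statement's English description precedes it below -/
import Mathlib

section
/- Assume (A1)–(A6) and α − β − 1 < 4θ/(β+1). For ρ > 0 let u(·,ρ) be the regular solution of L(u) + e^{f(u)} = 0 with u(0,ρ) = ρ and ∂_r u(0,ρ) = 0. Let u* : (0,∞) → ℝ be a C², strictly decreasing solution of L(u) + e^{f(u)} = 0 on (0,∞) with u*(r) → +∞ as r → 0+, satisfying u*(r) = F^{−1}( K r^{θ/(β+1)} (1 + δ(r)) ) where δ(r) → 0 as r → 0+, F(u) = ∫_u^∞ e^{−f(s)/(β+1)} ds and K = ((β+1)/θ)(α−β−1)^{−1/(β+1)}. Then for every δ' > 0 the number of zeros of u(·,ρ) − u* in the interval (0,δ') tends to +∞ as ρ → +∞; that is, for every N ∈ ℕ there exists ρ₀ such that for all ρ ≥ ρ₀ the set { r ∈ (0,δ') : u(r,ρ) = u*(r) } has at least N elements. -/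
open Filter Set Asymptotics Real MeasureTheory

theorem exp_sub_one_bounds {B x : ℝ} (hx : |x| ≤ B) :
    |exp x - 1| ≤ exp B * |x| ∧ |x| ≤ exp B * |exp x - 1| ∧ x ^ 2 ≤ exp B * (x * (exp x - 1)) ∧
      x * (exp x - 1) ≤ exp B * x ^ 2 := by
  obtain ⟨h1, h2⟩ := abs_le.1 hx
  have hB : 1 ≤ exp B := one_le_exp ((abs_nonneg x).trans hx)
  have e1 := add_one_le_exp x
  have e2 : exp x - 1 ≤ x * exp x := by
    have := add_one_le_exp (-x)
    have h3 : exp x * exp (-x) = 1 := by rw [← exp_add]; simp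
    nlinarith [exp_pos x]
  have e3 : exp x ≤ exp B := exp_le_exp.2 h2
  have e4 : 1 ≤ exp B * exp x := by
    rw [← exp_add]; exact one_le_exp (by linarith)
  have key : |exp x - 1| ≤ exp B * |x| ∧ |x| ≤ exp B * |exp x - 1| := by
    rcases le_total 0 x with h | h
    · rw [abs_of_nonneg h, abs_of_nonneg (by linarith)]
      constructor <;> nlinarith
    · have : exp x ≤ 1 := exp_le_one_iff.2 h
      rw [abs_of_nonpos h, abs_of_nonpos (by linarith)]
      constructor <;> nlinarith
  have hn : x * (exp x - 1) = |x| * |exp x - 1| := by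
    rw [← abs_mul, abs_of_nonneg]
    rcases le_total 0 x with h | h
    · exact mul_nonneg h (by linarith)
    · exact mul_nonneg_of_nonpos_of_nonpos h (by linarith [exp_le_one_iff.2 h])
  refine ⟨key.1, key.2, ?_, ?_⟩
  · rw [hn, ← sq_abs]; nlinarith [abs_nonneg x]
  · rw [hn, ← sq_abs]; nlinarith [abs_nonneg x]

theorem exp_sub_one_sub_bounds {B x : ℝ} (hx : |x| ≤ B) :
    x ^ 2 ≤ 4 * exp B ^ 2 * (exp x - 1 - x) ∧ exp x - 1 - x ≤ exp B * x ^ 2 := by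
  have hB : 1 ≤ exp B := one_le_exp ((abs_nonneg x).trans hx)
  constructor
  · have h2 : |x / 2| ≤ B := by
      rw [abs_div, abs_two]; linarith [abs_nonneg x]
    have h3 := (exp_sub_one_bounds h2).2.1
    have h4 : exp x = exp (x / 2) ^ 2 := by rw [← exp_nat_mul]; congr 1; push_cast; ring
    have h5 := add_one_le_exp (x / 2)
    have h6 : (x / 2) ^ 2 ≤ exp B ^ 2 * (exp (x / 2) - 1) ^ 2 := by
      rw [← mul_pow, ← sq_abs, ← sq_abs (exp B * _), abs_mul, abs_of_pos (exp_pos B)]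
      gcongr
    have h7 : (exp (x / 2) - 1) ^ 2 ≤ exp x - 1 - x := by rw [h4]; nlinarith
    nlinarith [mul_le_mul_of_nonneg_left h7 (sq_nonneg (exp B))]
  · have := (exp_sub_one_bounds hx).2.2.2
    have e2 : exp x - 1 ≤ x * exp x := by
      have := add_one_le_exp (-x)
      have h3 : exp x * exp (-x) = 1 := by rw [← exp_add]; simp
      nlinarith [exp_pos x]
    linarith

set_option maxHeartbeats 1000000 in
/-- On a bounded region, a small multiple of `x * y` turns the Lotka-Volterra energy into a strict
Lyapunov function, up to an error proportional to the perturbation `μ`. -/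
theorem exists_strict_lyapunov {A θ p B : ℝ} (hA : 0 < A) (hθ : 0 < θ) (hp : 0 < p) (hB : 0 ≤ B) :
    ∃ ε c k C : ℝ, 0 < c ∧ 0 < k ∧ 0 < C ∧ ∀ x y μ : ℝ, |x| ≤ B → |y| ≤ B →
      c * (x ^ 2 + y ^ 2) ≤ A * (exp x - 1 - x) + p * θ * (exp y - 1 - y) + ε * (x * y) ∧
      A * (exp x - 1 - x) + p * θ * (exp y - 1 - y) + ε * (x * y) ≤ C * (x ^ 2 + y ^ 2) ∧
      -(A ^ 2 * (exp x - 1) ^ 2) + μ * θ * exp y * (θ * (exp y - 1) - A * (exp x - 1)) +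
        ε * (y * (A * (1 - exp x) + θ * (1 - exp y) - θ * μ * exp y) +
          x * (A / p * (exp x - 1) + μ * θ * exp y / p)) ≤ -k * (x ^ 2 + y ^ 2) + C * |μ| ∧
      -C * (x ^ 2 + y ^ 2) - C * |μ| ≤
        -(A ^ 2 * (exp x - 1) ^ 2) + μ * θ * exp y * (θ * (exp y - 1) - A * (exp x - 1)) +
        ε * (y * (A * (1 - exp x) + θ * (1 - exp y) - θ * μ * exp y) +
          x * (A / p * (exp x - 1) + μ * θ * exp y / p)) := by
  obtain ⟨E, hE⟩ : ∃ E, E = exp B := ⟨_, rfl⟩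
  have hE1 : 1 ≤ E := hE ▸ one_le_exp hB
  have hE0 : 0 < E := by linarith
  obtain ⟨ε, hε, hε1, hε2, hε3⟩ : ∃ ε : ℝ, 0 < ε ∧ ε ≤ A / (4 * E ^ 2) ∧ ε ≤ p * θ / (4 * E ^ 2) ∧
      ε * (A ^ 2 * E ^ 3 / (2 * θ) + A / p * E) ≤ A ^ 2 / (2 * E ^ 2) := by
    have hden : 0 < A ^ 2 * E ^ 3 / (2 * θ) + A / p * E := by positivity
    refine ⟨min (min (A / (4 * E ^ 2)) (p * θ / (4 * E ^ 2)))
      (A ^ 2 / (2 * E ^ 2) / (A ^ 2 * E ^ 3 / (2 * θ) + A / p * E)), by positivity,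
      (min_le_left _ _).trans (min_le_left _ _), (min_le_left _ _).trans (min_le_right _ _), ?_⟩
    exact (le_div_iff₀ hden).1 (min_le_right _ _)
  obtain ⟨D, hD⟩ : ∃ D, D = θ * E * (θ * (E + 1) + A * (E + 1)) +
    ε * (B * (θ * E) + B * (θ * E / p)) := ⟨_, rfl⟩
  obtain ⟨C, hC⟩ : ∃ C, C = (A + p * θ) * E + ε + A ^ 2 * E ^ 2 +
    ε * (A * E + θ * E + A / p * E) + D := ⟨_, rfl⟩
  have hD0 : 0 ≤ D := by rw [hD]; positivity
  have hC0 : 0 < C := by rw [hC]; positivity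
  refine ⟨ε, ε / 2, min (A ^ 2 / (2 * E ^ 2)) (ε * θ / (2 * E)), C, by positivity, by positivity,
    hC0, fun x y μ hx hy => ?_⟩
  obtain ⟨a1, a2, a3, a4⟩ := exp_sub_one_bounds hx
  obtain ⟨b1, b2, b3, b4⟩ := exp_sub_one_bounds hy
  obtain ⟨a5, a6⟩ := exp_sub_one_sub_bounds hx
  obtain ⟨b5, b6⟩ := exp_sub_one_sub_bounds hy
  have ea : exp x ≤ E := hE ▸ exp_le_exp.2 (abs_le.1 hx).2
  have eb : exp y ≤ E := hE ▸ exp_le_exp.2 (abs_le.1 hy).2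
  have eb0 := exp_pos y
  have ea0 := exp_pos x
  rw [← hE] at a1 a2 a3 a4 a5 a6 b1 b2 b3 b4 b5 b6
  have hxy : |x * y| ≤ (x ^ 2 + y ^ 2) / 2 := by
    rw [abs_mul, ← sq_abs x, ← sq_abs y]; nlinarith [sq_nonneg (|x| - |y|)]
  obtain ⟨hxy1, hxy2⟩ := abs_le.1 hxy
  have aa : |exp x - 1| ≤ E + 1 := by rw [abs_le]; constructor <;> linarith
  have bb : |exp y - 1| ≤ E + 1 := by rw [abs_le]; constructor <;> linarith
  have hmu : |μ * θ * exp y * (θ * (exp y - 1) - A * (exp x - 1)) +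
      ε * (y * (-(θ * μ * exp y)) + x * (μ * θ * exp y / p))| ≤ D * |μ| := by
    have e1 : μ * θ * exp y * (θ * (exp y - 1) - A * (exp x - 1)) +
      ε * (y * (-(θ * μ * exp y)) + x * (μ * θ * exp y / p)) =
      μ * (θ * exp y * (θ * (exp y - 1) - A * (exp x - 1)) +
        ε * (-(y * (θ * exp y)) + x * (θ * exp y / p))) := by ring
    rw [e1, abs_mul, mul_comm D]
    gcongr
    refine (abs_add_le _ _).trans ?_
    rw [hD, abs_mul, abs_mul ε, abs_of_pos hε, abs_mul θ, abs_of_pos hθ, abs_of_pos eb0]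
    gcongr
    · refine (abs_sub _ _).trans ?_
      rw [abs_mul, abs_mul, abs_of_pos hA, abs_of_pos hθ]
      gcongr
    · refine (abs_add_le _ _).trans ?_
      rw [abs_neg, abs_mul, abs_mul x, abs_of_pos (by positivity : 0 < θ * exp y),
        abs_of_pos (by positivity : 0 < θ * exp y / p)]
      gcongr
  obtain ⟨hm1, hm2⟩ := abs_le.1 hmu
  have hay : |y * (exp x - 1)| ≤ E * |x| * |y| := by
    rw [abs_mul, mul_comm]; gcongr
  obtain ⟨hay1, hay2⟩ := abs_le.1 hay
  have ha2 : x ^ 2 ≤ E ^ 2 * (exp x - 1) ^ 2 := by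
    rw [← mul_pow, ← sq_abs, ← sq_abs (E * _), abs_mul, abs_of_pos hE0]; gcongr
  have ha2' : (exp x - 1) ^ 2 ≤ E ^ 2 * x ^ 2 := by
    rw [← mul_pow, ← sq_abs, ← sq_abs (E * _), abs_mul, abs_of_pos hE0]; gcongr
  rw [le_div_iff₀ (by positivity)] at hε1 hε2
  refine ⟨?_, ?_, ?_, ?_⟩
  · have l1 : ε * x ^ 2 ≤ A * (exp x - 1 - x) := by
      have h0 : 0 ≤ exp x - 1 - x := by linarith [add_one_le_exp x]
      calc ε * x ^ 2 ≤ ε * (4 * E ^ 2 * (exp x - 1 - x)) := by gcongr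
        _ = (ε * (4 * E ^ 2)) * (exp x - 1 - x) := by ring
        _ ≤ _ := by gcongr
    have l2 : ε * y ^ 2 ≤ p * θ * (exp y - 1 - y) := by
      have h0 : 0 ≤ exp y - 1 - y := by linarith [add_one_le_exp y]
      calc ε * y ^ 2 ≤ ε * (4 * E ^ 2 * (exp y - 1 - y)) := by gcongr
        _ = (ε * (4 * E ^ 2)) * (exp y - 1 - y) := by ring
        _ ≤ _ := by gcongr
    have l3 := mul_le_mul_of_nonneg_left hxy1 hε.le
    linarith only [l1, l2, l3]
  · have l1 := mul_le_mul_of_nonneg_left a6 hA.le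
    have l2 := mul_le_mul_of_nonneg_left b6 (by positivity : 0 ≤ p * θ)
    have l3 := mul_le_mul_of_nonneg_left hxy2 hε.le
    have l4 : 0 ≤ (A * E * y ^ 2 + p * θ * E * x ^ 2) + ε * (x ^ 2 + y ^ 2) / 2 +
      (A ^ 2 * E ^ 2 + ε * (A * E + θ * E + A / p * E) + D) * (x ^ 2 + y ^ 2) := by positivity
    rw [hC]; linarith only [l1, l2, l3, l4]
  · have l1 : x ^ 2 / E ^ 2 ≤ (exp x - 1) ^ 2 := by
      rw [div_le_iff₀ (by positivity)]; linarith
    have l2 : y ^ 2 / E ≤ y * (exp y - 1) := by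
      rw [div_le_iff₀ (by positivity)]; linarith
    have l3 : A * (E * |x| * |y|) ≤ A ^ 2 * E ^ 3 / (2 * θ) * x ^ 2 + θ / (2 * E) * y ^ 2 := by
      rw [← sq_abs x, ← sq_abs y]
      have : 0 ≤ (A * E ^ 2 * |x| - θ * |y|) ^ 2 / (2 * θ * E) := by positivity
      have e : A ^ 2 * E ^ 3 / (2 * θ) * |x| ^ 2 + θ / (2 * E) * |y| ^ 2 - A * (E * |x| * |y|)
        = (A * E ^ 2 * |x| - θ * |y|) ^ 2 / (2 * θ * E) := by field_simp; ring
      linarith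
    have l4 : A * (y * (1 - exp x)) ≤ A * (E * |x| * |y|) :=
      mul_le_mul_of_nonneg_left (by linarith) hA.le
    have l5 : A / p * (x * (exp x - 1)) ≤ A / p * (E * x ^ 2) := by gcongr
    have l6 : θ * (y ^ 2 / E) ≤ θ * (y * (exp y - 1)) := by gcongr
    have l7 : A ^ 2 * (x ^ 2 / E ^ 2) ≤ A ^ 2 * (exp x - 1) ^ 2 := by gcongr
    have l8 : ε * (A * (y * (1 - exp x)) - θ * (y * (exp y - 1)) + A / p * (x * (exp x - 1))) ≤
        ε * (A ^ 2 * E ^ 3 / (2 * θ) * x ^ 2 + θ / (2 * E) * y ^ 2 - θ * (y ^ 2 / E)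
          + A / p * (E * x ^ 2)) := by gcongr; linarith
    have l9 := mul_le_mul_of_nonneg_right hε3 (sq_nonneg x)
    have l10 : D * |μ| ≤ C * |μ| := by
      gcongr; rw [hC]
      have : 0 ≤ (A + p * θ) * E + ε + A ^ 2 * E ^ 2 + ε * (A * E + θ * E + A / p * E) := by positivity
      linarith
    have l11 : min (A ^ 2 / (2 * E ^ 2)) (ε * θ / (2 * E)) * (x ^ 2 + y ^ 2) ≤
        A ^ 2 / (2 * E ^ 2) * x ^ 2 + ε * θ / (2 * E) * y ^ 2 := by
      rw [mul_add]; gcongr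
      · exact min_le_left _ _
      · exact min_le_right _ _
    have e1 : A ^ 2 * (x ^ 2 / E ^ 2) = 2 * (A ^ 2 / (2 * E ^ 2) * x ^ 2) := by field_simp
    have e2 : ε * (A ^ 2 * E ^ 3 / (2 * θ) * x ^ 2 + θ / (2 * E) * y ^ 2 - θ * (y ^ 2 / E)
          + A / p * (E * x ^ 2)) = ε * (A ^ 2 * E ^ 3 / (2 * θ) + A / p * E) * x ^ 2
          - ε * θ / (2 * E) * y ^ 2 := by field_simp; ring
    linarith only [hm2, l7, l8, l9, l10, l11, e1, e2]
  · have l1 : A ^ 2 * (exp x - 1) ^ 2 ≤ A ^ 2 * (E ^ 2 * x ^ 2) := by gcongr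
    have l2 : -(ε * (A * (E * ((x ^ 2 + y ^ 2) / 2)) + θ * (E * y ^ 2))) ≤
        ε * (A * (y * (1 - exp x)) - θ * (y * (exp y - 1)) + A / p * (x * (exp x - 1))) := by
      have m1 : A * (y * (exp x - 1)) ≤ A * (E * ((x ^ 2 + y ^ 2) / 2)) := by
        refine mul_le_mul_of_nonneg_left (hay2.trans ?_) hA.le
        rw [mul_assoc, ← abs_mul]; gcongr
      have m2 : θ * (y * (exp y - 1)) ≤ θ * (E * y ^ 2) := by gcongr
      have m3 : 0 ≤ A / p * (x * (exp x - 1)) := by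
        have : 0 ≤ x * (exp x - 1) :=
          le_of_mul_le_mul_left (by simpa using (sq_nonneg x).trans a3) hE0
        positivity
      rw [← mul_neg]
      exact mul_le_mul_of_nonneg_left (by linarith) hε.le
    have l10 : D * |μ| ≤ C * |μ| := by
      gcongr; rw [hC]
      have : 0 ≤ (A + p * θ) * E + ε + A ^ 2 * E ^ 2 + ε * (A * E + θ * E + A / p * E) := by positivity
      linarith
    have l12 : 0 ≤ ((A + p * θ) * E + ε + ε * (A / p * E) + D) * (x ^ 2 + y ^ 2) +
      A ^ 2 * E ^ 2 * y ^ 2 + ε * A * E * ((x ^ 2 + y ^ 2) / 2) + ε * (θ * E) * x ^ 2 := by positivity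
    have e0 : C * (x ^ 2 + y ^ 2) = ((A + p * θ) * E + ε + ε * (A / p * E) + D) * (x ^ 2 + y ^ 2) +
      A ^ 2 * E ^ 2 * y ^ 2 + ε * A * E * ((x ^ 2 + y ^ 2) / 2) + ε * (θ * E) * x ^ 2
      + A ^ 2 * (E ^ 2 * x ^ 2) + ε * (A * (E * ((x ^ 2 + y ^ 2) / 2)) + θ * (E * y ^ 2)) := by
      rw [hC]; ring
    linarith only [hm1, l1, l2, l10, l12, e0]

/-- A differential inequality `W' ≤ -k W + e` gives exponential decay up to `e / k`. -/
theorem le_of_deriv_le_neg_mul_add {W W' : ℝ → ℝ} {a b k e : ℝ} (hk : 0 < k) (he : 0 ≤ e)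
    (hW : ∀ t ∈ Icc a b, HasDerivAt W (W' t) t) (hW' : ∀ t ∈ Icc a b, W' t ≤ -k * W t + e) :
    ∀ t ∈ Icc a b, W t ≤ W a * exp (-k * (t - a)) + e / k := by
  have hd : ∀ t ∈ Icc a b, HasDerivAt (fun t => (W t - e / k) * exp (k * (t - a)))
      (W' t * exp (k * (t - a)) + (W t - e / k) * (exp (k * (t - a)) * k)) t := fun t ht => by
    have h1 : HasDerivAt (fun t => k * (t - a)) k t := by
      simpa using ((hasDerivAt_id t).sub_const a).const_mul k
    exact ((hW t ht).sub_const _).mul h1.exp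
  have hanti : AntitoneOn (fun t => (W t - e / k) * exp (k * (t - a))) (Icc a b) := by
    refine antitoneOn_of_hasDerivWithinAt_nonpos (convex_Icc a b)
      (fun t ht => (hd t ht).continuousAt.continuousWithinAt)
      (fun t ht => (hd t (interior_subset ht)).hasDerivWithinAt) fun t ht => ?_
    have h1 := hW' t (interior_subset ht)
    have h2 : W' t * exp (k * (t - a)) + (W t - e / k) * (exp (k * (t - a)) * k) =
        (W' t + k * W t - e) * exp (k * (t - a)) := by field_simp; ring
    rw [h2]
    exact mul_nonpos_of_nonpos_of_nonneg (by linarith) (exp_pos _).le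
  intro t ht
  have h := hanti (left_mem_Icc.2 (ht.1.trans ht.2)) ht ht.1
  simp only [sub_self, mul_zero, exp_zero, mul_one] at h
  have h3 : exp (k * (t - a)) * exp (-k * (t - a)) = 1 := by rw [← exp_add]; simp
  have h4 := mul_le_mul_of_nonneg_right h (exp_pos (-k * (t - a))).le
  rw [mul_assoc, h3] at h4
  have : 0 ≤ e / k * exp (-k * (t - a)) := by positivity
  nlinarith

/-- A perturbed planar spiral keeps rotating: its real part alternates in sign. -/
theorem exists_alternating_of_perturbed_rotation {A ω : ℝ} (hA : 0 < A) (hω : 0 < ω) (N : ℕ)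
    {Z Z' : ℝ → ℂ} {a ε : ℝ}
    (hZ : ∀ t ∈ Icc a (a + (N + 3) * π / ω), HasDerivAt Z (Z' t) t)
    (hZ' : ∀ t ∈ Icc a (a + (N + 3) * π / ω),
      ‖Z' t + ((A / 2 : ℝ) + (ω : ℝ) * Complex.I) * Z t‖ ≤ ε)
    (hε : exp (A / 2 * ((N + 3) * π / ω)) * ε * ((N + 3) * π / ω) ≤ ‖Z a‖ / 2) :
    ∃ τ : ℕ → ℝ, StrictMono τ ∧ ∀ k ≤ N, τ k ∈ Icc a (a + (N + 3) * π / ω) ∧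
      exp (-(A / 2 * ((N + 3) * π / ω))) * (‖Z a‖ / 2) ≤ (-1) ^ k * (Z (τ k)).re := by
  set T := (N + 3) * π / ω with hT
  have hadd : a + (N + 3) * π / ω = a + T := rfl
  rw [hadd] at hZ hZ' ⊢
  set c : ℂ := (A / 2 : ℝ) + (ω : ℝ) * Complex.I with hc
  have hre : ∀ s : ℝ, ‖Complex.exp (c * s)‖ = exp (A / 2 * s) := fun s => by
    rw [Complex.norm_exp]; congr 1; simp [hc]
  set ξ : ℝ → ℂ := fun t => Complex.exp (c * ((t - a : ℝ) : ℂ)) * Z t with hξ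
  have hdξ : ∀ t ∈ Icc a (a + T), HasDerivWithinAt ξ
      (Complex.exp (c * ((t - a : ℝ) : ℂ)) * (Z' t + c * Z t)) (Icc a (a + T)) t := fun t ht => by
    have h1 : HasDerivAt (fun t : ℝ => c * ((t - a : ℝ) : ℂ)) c t := by
      simpa using (((hasDerivAt_id t).sub_const a).ofReal_comp).const_mul c
    have := (h1.cexp.mul (hZ t ht)).hasDerivWithinAt (s := Icc a (a + T))
    refine this.congr_deriv ?_
    ring
  have hT0 : 0 ≤ T := by positivity
  have hε0 : 0 ≤ ε := (norm_nonneg _).trans (hZ' a ⟨le_rfl, by linarith⟩)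
  have hclose : ∀ t ∈ Icc a (a + T), ‖ξ t - Z a‖ ≤ ‖Z a‖ / 2 := fun t ht => by
    have h0 : ξ a = Z a := by simp [hξ]
    rw [← h0]
    refine (Convex.norm_image_sub_le_of_norm_hasDerivWithin_le hdξ
      (C := exp (A / 2 * T) * ε) (fun s hs => ?_) (convex_Icc _ _)
      (left_mem_Icc.2 (by linarith)) ht).trans (le_trans ?_ (hε.trans_eq (by rw [h0])))
    · rw [norm_mul, hre]
      gcongr
      · linarith [hs.2]
      · exact hZ' s hs
    · rw [Real.norm_eq_abs, abs_of_nonneg (by linarith [ht.1])]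
      gcongr
      linarith [ht.2]
  refine ⟨fun k => a + (Complex.arg (Z a) + (k + 2) * π) / ω, ?_, fun k hk => ?_⟩
  · intro i j hij
    have : (i : ℝ) < j := by exact_mod_cast hij
    dsimp only
    gcongr
  · set s := (Complex.arg (Z a) + (k + 2) * π) / ω with hs
    have harg := Complex.neg_pi_lt_arg (Z a)
    have harg' := Complex.arg_le_pi (Z a)
    have hk' : (k : ℝ) ≤ N := by exact_mod_cast hk
    have hs0 : 0 ≤ s := by
      apply div_nonneg _ hω.le
      nlinarith [pi_pos, (Nat.cast_nonneg k : (0:ℝ) ≤ k)]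
    have hsT : s ≤ T := by
      rw [hs, hT]
      gcongr
      nlinarith [pi_pos]
    have hmem : a + s ∈ Icc a (a + T) := ⟨by linarith, by linarith⟩
    refine ⟨hmem, ?_⟩
    have h1 := hclose _ hmem
    have hωs : ω * s = Complex.arg (Z a) + (k + 2) * π := by rw [hs]; field_simp
    have hZs : Z (a + s) = exp (-(A / 2 * s)) *
        (Complex.exp (-(ω * s : ℝ) * Complex.I) * ξ (a + s)) := by
      simp only [hξ, add_sub_cancel_left]
      rw [Complex.ofReal_exp, ← mul_assoc, ← mul_assoc, ← Complex.exp_add, ← Complex.exp_add]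
      have : ((-(A / 2 * s) : ℝ) : ℂ) + -((ω * s : ℝ) : ℂ) * Complex.I + c * (s : ℂ) = 0 := by
        rw [hc]; push_cast; ring
      rw [this]; simp
    have hmain : Complex.exp (-(ω * s : ℝ) * Complex.I) * Z a = ((-1) ^ k * ‖Z a‖ : ℝ) := by
      conv_lhs => rw [← Complex.norm_mul_exp_arg_mul_I (Z a)]
      rw [mul_left_comm, ← Complex.exp_add, hωs]
      have : -((Complex.arg (Z a) + (k + 2) * π : ℝ) : ℂ) * Complex.I +
          (Complex.arg (Z a) : ℂ) * Complex.I = (((k + 2 : ℕ) : ℂ)) * (-(π * Complex.I)) := by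
        push_cast; ring
      rw [this, Complex.exp_nat_mul, Complex.exp_neg, Complex.exp_pi_mul_I]
      push_cast
      rw [pow_add]; norm_num; ring
    have hsplit : (-1) ^ k * (Z (a + s)).re = exp (-(A / 2 * s)) * (‖Z a‖ +
        (-1) ^ k * (Complex.exp (-(ω * s : ℝ) * Complex.I) * (ξ (a + s) - Z a)).re) := by
      rw [hZs, Complex.re_ofReal_mul]
      have : Complex.exp (-(ω * s : ℝ) * Complex.I) * ξ (a + s) = ((-1) ^ k * ‖Z a‖ : ℝ) +
          Complex.exp (-(ω * s : ℝ) * Complex.I) * (ξ (a + s) - Z a) := by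
        rw [← hmain]; ring
      rw [this, Complex.add_re, Complex.ofReal_re]
      have h2 : ((-1 : ℝ) ^ k) * (-1) ^ k = 1 := by rw [← mul_pow]; simp
      linear_combination exp (-(A / 2 * s)) * ‖Z a‖ * h2
    have hrem : |(-1 : ℝ) ^ k * (Complex.exp (-(ω * s : ℝ) * Complex.I) * (ξ (a + s) - Z a)).re| ≤
        ‖Z a‖ / 2 := by
      rw [abs_mul, abs_pow, abs_neg, abs_one, one_pow, one_mul]
      refine (Complex.abs_re_le_norm _).trans ?_
      rw [norm_mul]
      have : ‖Complex.exp (-(ω * s : ℝ) * Complex.I)‖ = 1 := by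
        rw [← Complex.ofReal_neg, Complex.norm_exp_ofReal_mul_I]
      rw [this, one_mul]
      exact h1
    rw [hsplit]
    gcongr
    linarith [(abs_le.1 hrem).1]

set_option maxHeartbeats 400000 in
/-- In the coordinates `z = x + p y` and `v = z' + A z / 2` the perturbed Lotka-Volterra system is
a damped rotation up to quadratic terms and the perturbation. -/
theorem exists_spiral_bounds {A θ p B ω : ℝ} (hA : 0 < A) (hθ : 0 < θ) (hp : 0 < p) (hω : 0 < ω) :
    ∃ C : ℝ, 0 < C ∧ ∀ x y μ : ℝ, |x| ≤ B → |y| ≤ B →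
      x ^ 2 + y ^ 2 ≤ C * ((ω * (x + p * y)) ^ 2 + (θ * (1 - exp y) + A / 2 * (x + p * y)) ^ 2) ∧
      |-θ * exp y * (A / p * (exp x - 1) + μ * θ * exp y / p) + A * (θ * (1 - exp y)) +
        A * θ / p * (x + p * y)| ≤ C * (x ^ 2 + y ^ 2) + C * |μ| := by
  obtain ⟨E, hE⟩ : ∃ E, E = exp B := ⟨_, rfl⟩
  have hE0 : 0 < E := hE ▸ exp_pos B
  obtain ⟨c₁, hc₁⟩ : ∃ c₁, c₁ = 2 / θ ^ 2 * (A ^ 2 / (4 * ω ^ 2) + 1) := ⟨_, rfl⟩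
  have hc₁0 : 0 < c₁ := by rw [hc₁]; positivity
  obtain ⟨C₁, hC₁⟩ : ∃ C₁, C₁ = 2 / ω ^ 2 + 2 * p ^ 2 * (E ^ 2 * c₁) + E ^ 2 * c₁ := ⟨_, rfl⟩
  obtain ⟨C₂, hC₂⟩ : ∃ C₂, C₂ = A * θ / p * (E + E ^ 2 / 2) + A * θ * E := ⟨_, rfl⟩
  have hC₁0 : 0 < C₁ := by rw [hC₁]; positivity
  have hC₂0 : 0 < C₂ := by rw [hC₂]; positivity
  have hC₃0 : 0 < θ ^ 2 * E ^ 2 / p := by positivity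
  refine ⟨C₁ + C₂ + θ ^ 2 * E ^ 2 / p, by positivity, fun x y μ hx hy => ?_⟩
  obtain ⟨a1, -, -, -⟩ := exp_sub_one_bounds hx
  obtain ⟨b1, b2, -, -⟩ := exp_sub_one_bounds hy
  have a6 := (exp_sub_one_sub_bounds hx).2
  have b6 := (exp_sub_one_sub_bounds hy).2
  have a0 : 0 ≤ exp x - 1 - x := by linarith [add_one_le_exp x]
  have b0 : 0 ≤ exp y - 1 - y := by linarith [add_one_le_exp y]
  have eb : exp y ≤ E := hE ▸ exp_le_exp.2 (abs_le.1 hy).2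
  rw [← hE] at a1 a6 b1 b2 b6
  constructor
  · obtain ⟨z, hz⟩ : ∃ z, z = x + p * y := ⟨_, rfl⟩
    obtain ⟨v, hv⟩ : ∃ v, v = θ * (1 - exp y) + A / 2 * z := ⟨_, rfl⟩
    rw [← hz, ← hv]
    have hP0 : 0 ≤ (ω * z) ^ 2 + v ^ 2 := by positivity
    have hz2 : z ^ 2 ≤ 1 / ω ^ 2 * ((ω * z) ^ 2 + v ^ 2) := by
      have : z ^ 2 = 1 / ω ^ 2 * (ω * z) ^ 2 := by field_simp
      rw [this]; gcongr; linarith [sq_nonneg v]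
    have hb2 : (exp y - 1) ^ 2 ≤ c₁ * ((ω * z) ^ 2 + v ^ 2) := by
      have h1 : (exp y - 1) ^ 2 = 1 / θ ^ 2 * (A / 2 * z - v) ^ 2 := by rw [hv]; field_simp; ring
      have h2 : (A / 2 * z - v) ^ 2 ≤ 2 * (A ^ 2 / 4 * z ^ 2 + v ^ 2) := by
        linarith only [sq_nonneg (A / 2 * z + v)]
      have h3 : c₁ * ((ω * z) ^ 2 + v ^ 2) = 1 / θ ^ 2 * (2 * (A ^ 2 / 4 * (1 / ω ^ 2 *
        ((ω * z) ^ 2 + v ^ 2)) + ((ω * z) ^ 2 + v ^ 2))) := by rw [hc₁]; field_simp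
      rw [h1, h3]
      gcongr
      refine h2.trans ?_
      gcongr
      linarith [sq_nonneg (ω * z)]
    have hy2 : y ^ 2 ≤ E ^ 2 * c₁ * ((ω * z) ^ 2 + v ^ 2) := by
      have : y ^ 2 ≤ E ^ 2 * (exp y - 1) ^ 2 := by
        rw [← mul_pow, ← sq_abs, ← sq_abs (E * _), abs_mul, abs_of_pos hE0]; gcongr
      refine this.trans ?_
      rw [mul_assoc]; gcongr
    have hx2 : x ^ 2 ≤ 2 * z ^ 2 + 2 * p ^ 2 * y ^ 2 := by
      have : x = z - p * y := by rw [hz]; ring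
      rw [this]; linarith only [sq_nonneg (z + p * y)]
    have h4 := mul_le_mul_of_nonneg_left hy2 (by positivity : 0 ≤ 2 * p ^ 2)
    have h5 : 0 ≤ (C₂ + θ ^ 2 * E ^ 2 / p) * ((ω * z) ^ 2 + v ^ 2) := by positivity
    have h6 : C₁ * ((ω * z) ^ 2 + v ^ 2) = 2 * (1 / ω ^ 2 * ((ω * z) ^ 2 + v ^ 2)) +
      2 * p ^ 2 * (E ^ 2 * c₁ * ((ω * z) ^ 2 + v ^ 2)) + E ^ 2 * c₁ * ((ω * z) ^ 2 + v ^ 2) := by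
      rw [hC₁]; ring
    linarith only [hx2, hy2, hz2, h4, h5, h6]
  · have e1 : -θ * exp y * (A / p * (exp x - 1) + μ * θ * exp y / p) + A * (θ * (1 - exp y)) +
        A * θ / p * (x + p * y) = -(A * θ / p * ((exp x - 1 - x) + (exp y - 1) * (exp x - 1)) +
        A * θ * (exp y - 1 - y) + μ * (θ ^ 2 * exp y ^ 2 / p)) := by field_simp; ring
    rw [e1, abs_neg]
    have hab : |(exp y - 1) * (exp x - 1)| ≤ E ^ 2 / 2 * (x ^ 2 + y ^ 2) := by
      rw [abs_mul]
      calc _ ≤ (E * |y|) * (E * |x|) := by gcongr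
        _ = E ^ 2 * (|x| * |y|) := by ring
        _ ≤ E ^ 2 * ((x ^ 2 + y ^ 2) / 2) := by
          gcongr
          rw [← sq_abs x, ← sq_abs y]; nlinarith [sq_nonneg (|x| - |y|)]
        _ = _ := by ring
    have h1 : |A * θ / p * ((exp x - 1 - x) + (exp y - 1) * (exp x - 1))| ≤
        A * θ / p * (E * x ^ 2 + E ^ 2 / 2 * (x ^ 2 + y ^ 2)) := by
      rw [abs_mul, abs_of_pos (by positivity : 0 < A * θ / p)]
      gcongr
      refine (abs_add_le _ _).trans ?_
      rw [abs_of_nonneg a0]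
      gcongr
    have h2 : |A * θ * (exp y - 1 - y)| ≤ A * θ * (E * y ^ 2) := by
      rw [abs_mul, abs_of_pos (by positivity : 0 < A * θ), abs_of_nonneg b0]
      gcongr
    have h3 : |μ * (θ ^ 2 * exp y ^ 2 / p)| ≤ θ ^ 2 * E ^ 2 / p * |μ| := by
      rw [abs_mul, mul_comm, abs_of_pos (by positivity : 0 < θ ^ 2 * exp y ^ 2 / p)]
      gcongr
    have h4 : C₂ * (x ^ 2 + y ^ 2) = A * θ / p * (E * x ^ 2 + E ^ 2 / 2 * (x ^ 2 + y ^ 2)) +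
      A * θ * (E * y ^ 2) + (A * θ / p * E * y ^ 2 + A * θ * E * x ^ 2) := by rw [hC₂]; ring
    have h5 : 0 ≤ A * θ / p * E * y ^ 2 + A * θ * E * x ^ 2 := by positivity
    have h6 : 0 ≤ (C₁ + θ ^ 2 * E ^ 2 / p) * (x ^ 2 + y ^ 2) + (C₁ + C₂) * |μ| := by positivity
    have h7 := abs_add_three (A * θ / p * ((exp x - 1 - x) + (exp y - 1) * (exp x - 1)))
      (A * θ * (exp y - 1 - y)) (μ * (θ ^ 2 * exp y ^ 2 / p))
    linarith only [h1, h2, h3, h4, h5, h6, h7]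

theorem abs_le_of_exp_sub_one_sub_le {x R : ℝ} (h : exp x - 1 - x ≤ R) : |x| ≤ 1 + R := by
  rcases le_total 0 x with hx | hx
  · rw [abs_of_nonneg hx]
    nlinarith [quadratic_le_exp_of_nonneg hx, sq_nonneg (x - 1)]
  · rw [abs_of_nonpos hx]
    linarith [exp_pos x]

theorem eventually_const_mul_lt (C : ℝ) {w : ℝ} (hw : 0 < w) :
    ∀ᶠ η in nhdsWithin (0 : ℝ) (Ioi 0), C * η < w := by
  have h : Tendsto (fun η : ℝ => C * η) (nhdsWithin 0 (Ioi 0)) (nhds (C * 0)) :=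
    (tendsto_id.const_mul C).mono_left nhdsWithin_le_nhds
  exact h.eventually_lt_const (by simpa using hw)

/-- Solutions of the Lotka-Volterra system with a small perturbation stay bounded over a given
time span. -/
theorem exists_bound_of_perturbed_lotkaVolterra {A θ p M : ℝ} (hA : 0 < A) (hθ : 0 < θ)
    (hp : 0 < p) (hM : 0 ≤ M) :
    ∃ B : ℝ, 0 ≤ B ∧ ∀ T : ℝ, 0 < T → ∀ᶠ η in nhdsWithin (0 : ℝ) (Ioi 0), ∀ x y μ : ℝ → ℝ,
      (∀ t ∈ Icc 0 T, HasDerivAt x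
        (A * (1 - exp (x t)) + θ * (1 - exp (y t)) - θ * μ t * exp (y t)) t) →
      (∀ t ∈ Icc 0 T, HasDerivAt y (A / p * (exp (x t) - 1) + μ t * θ * exp (y t) / p) t) →
      (∀ t ∈ Icc 0 T, |μ t| ≤ η) → |x 0| ≤ M → |y 0| ≤ M →
      ∀ t ∈ Icc 0 T, |x t| ≤ B ∧ |y t| ≤ B := by
  set R := (A + p * θ) * (exp M + M) + 1 with hR
  have hR0 : 0 < R := by positivity
  set B := 1 + (R / A + R / (p * θ)) with hB
  have hB' : ∀ x y : ℝ, A * (exp x - 1 - x) + p * θ * (exp y - 1 - y) ≤ R → |x| ≤ B ∧ |y| ≤ B := by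
    intro x y h
    have hx0 : 0 ≤ A * (exp x - 1 - x) := mul_nonneg hA.le (by linarith [add_one_le_exp x])
    have hy0 : 0 ≤ p * θ * (exp y - 1 - y) :=
      mul_nonneg (by positivity) (by linarith [add_one_le_exp y])
    have h1 : 0 ≤ R / A := by positivity
    have h2 : 0 ≤ R / (p * θ) := by positivity
    refine ⟨(abs_le_of_exp_sub_one_sub_le (R := R / A) ?_).trans (by linarith),
      (abs_le_of_exp_sub_one_sub_le (R := R / (p * θ)) ?_).trans (by linarith)⟩
    · rw [le_div_iff₀ hA]; linarith
    · rw [le_div_iff₀ (by positivity)]; linarith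
  refine ⟨B, by positivity, fun T hT => ?_⟩
  filter_upwards [eventually_const_mul_lt (θ * exp B * (θ * (exp B + 1) + A * (exp B + 1)))
    (by positivity : 0 < 1 / T), self_mem_nhdsWithin] with η hη hη0 x y μ hx hy hμ hx0 hy0 t ht
  set V : ℝ → ℝ := fun t => A * (exp (x t) - 1 - x t) + p * θ * (exp (y t) - 1 - y t) with hV
  have hVd : ∀ t ∈ Icc 0 T, HasDerivAt V (-(A ^ 2 * (exp (x t) - 1) ^ 2) +
      μ t * θ * exp (y t) * (θ * (exp (y t) - 1) - A * (exp (x t) - 1))) t := fun t ht => by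
    refine ((((hx t ht).exp.sub_const 1).sub (hx t ht)).const_mul A |>.add
      ((((hy t ht).exp.sub_const 1).sub (hy t ht)).const_mul (p * θ))).congr_deriv ?_
    field_simp; ring
  have hexp : ∀ {s : ℝ}, |s| ≤ M → exp s - 1 - s ≤ exp M + M := fun {s} hs => by
    have := exp_le_exp.2 (abs_le.1 hs).2
    linarith [(abs_le.1 hs).1]
  have hbarrier : ∀ t ∈ Icc 0 T, V t ≤ R - 1 + 1 / T * t := by
    intro t ht
    refine image_le_of_deriv_right_lt_deriv_boundary (a := 0) (b := T) (f := V)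
      (B := fun t => R - 1 + 1 / T * t) (B' := fun _ => 1 / T)
      (fun s hs => (hVd s hs).continuousAt.continuousWithinAt)
      (fun s hs => (hVd s ⟨hs.1, hs.2.le⟩).hasDerivWithinAt) ?_
      (fun s => by simpa using ((hasDerivAt_id s).const_mul (1 / T)).const_add (R - 1)) ?_ ht
    · have h1 := mul_le_mul_of_nonneg_left (hexp hx0) hA.le
      have h2 := mul_le_mul_of_nonneg_left (hexp hy0) (by positivity : 0 ≤ p * θ)
      simp only [hV, hR, mul_zero, add_zero]
      linarith
    · intro s hs hVs
      have hle : V s ≤ R := by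
        rw [hVs]
        have : 1 / T * s ≤ 1 := by rw [div_mul_eq_mul_div, one_mul, div_le_one hT]; exact hs.2.le
        linarith
      obtain ⟨hxB, hyB⟩ := hB' _ _ hle
      have ex : exp (x s) ≤ exp B := exp_le_exp.2 (abs_le.1 hxB).2
      have ey : exp (y s) ≤ exp B := exp_le_exp.2 (abs_le.1 hyB).2
      have ax : |exp (x s) - 1| ≤ exp B + 1 := by
        rw [abs_le]; constructor <;> linarith [exp_pos (x s), exp_pos B]
      have ay : |exp (y s) - 1| ≤ exp B + 1 := by
        rw [abs_le]; constructor <;> linarith [exp_pos (y s), exp_pos B]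
      have h1 : |μ s * θ * exp (y s) * (θ * (exp (y s) - 1) - A * (exp (x s) - 1))| ≤
          η * θ * exp B * (θ * (exp B + 1) + A * (exp B + 1)) := by
        rw [abs_mul, abs_mul, abs_mul, abs_of_pos hθ, abs_of_pos (exp_pos _)]
        have hη0' : 0 ≤ η := le_of_lt hη0
        gcongr
        · exact hμ s ⟨hs.1, hs.2.le⟩
        · refine (abs_sub _ _).trans ?_
          rw [abs_mul, abs_mul, abs_of_pos hA, abs_of_pos hθ]
          gcongr
      have h2 : 0 ≤ A ^ 2 * (exp (x s) - 1) ^ 2 := by positivity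
      have h3 := (abs_le.1 h1).2
      linarith
  refine hB' _ _ ((hbarrier t ht).trans ?_)
  have : 1 / T * t ≤ 1 := by rw [div_mul_eq_mul_div, one_mul, div_le_one hT]; exact ht.2
  linarith

set_option maxHeartbeats 1000000 in
/-- Trajectories of the Lotka-Volterra system with a small perturbation, started in a bounded set
away from the equilibrium, spiral around it as often as prescribed. -/
theorem exists_alternating_of_perturbed_lotkaVolterra {A θ p c M : ℝ} (hA : 0 < A) (hθ : 0 < θ)
    (hp : 0 < p) (hdisc : A < 4 * θ / p) (hc : 0 < c) (hM : 0 ≤ M) (N : ℕ) :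
    ∃ T η d : ℝ, 0 < T ∧ 0 < η ∧ 0 < d ∧ ∀ x y μ : ℝ → ℝ,
      (∀ t ∈ Icc 0 T, HasDerivAt x
        (A * (1 - exp (x t)) + θ * (1 - exp (y t)) - θ * μ t * exp (y t)) t) →
      (∀ t ∈ Icc 0 T, HasDerivAt y (A / p * (exp (x t) - 1) + μ t * θ * exp (y t) / p) t) →
      (∀ t ∈ Icc 0 T, |μ t| ≤ η) → c ≤ x 0 → x 0 ≤ M → |y 0| ≤ M →
      ∃ τ : ℕ → ℝ, StrictMono τ ∧ ∀ k ≤ N, τ k ∈ Icc 0 T ∧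
        d ≤ (-1) ^ k * (x (τ k) + p * y (τ k)) := by
  have hω2 : 0 < A * θ / p - A ^ 2 / 4 := by
    rw [lt_div_iff₀ hp] at hdisc
    have : A * θ / p - A ^ 2 / 4 = A * (4 * θ - A * p) / (4 * p) := by field_simp
    rw [this]
    have : 0 < 4 * θ - A * p := by linarith
    positivity
  obtain ⟨ω, hω, hωsq⟩ : ∃ ω : ℝ, 0 < ω ∧ ω ^ 2 = A * θ / p - A ^ 2 / 4 :=
    ⟨_, sqrt_pos.2 hω2, sq_sqrt hω2.le⟩
  obtain ⟨B, hB, hbound⟩ := exists_bound_of_perturbed_lotkaVolterra hA hθ hp hM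
  obtain ⟨ε, c₁, k, C₁, hc₁, hk, hC₁, hlyap⟩ := exists_strict_lyapunov hA hθ hp hB
  obtain ⟨C₂, hC₂, hspiral⟩ := exists_spiral_bounds (B := B) hA hθ hp hω
  obtain ⟨S, hS⟩ : ∃ S : ℝ, S = (N + 3) * π / ω := ⟨_, rfl⟩
  have hS0 : 0 < S := by rw [hS]; positivity
  obtain ⟨G, hG⟩ : ∃ G : ℝ, G = exp (A / 2 * S) * S := ⟨_, rfl⟩
  have hG0 : 0 < G := by rw [hG]; positivity
  obtain ⟨C₃, hC₃⟩ : ∃ C₃ : ℝ, C₃ = C₂ * (2 / c₁ + 1) := ⟨_, rfl⟩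
  have hC₃0 : 0 < C₃ := by rw [hC₃]; positivity
  obtain ⟨w₁, hw₁⟩ : ∃ w₁ : ℝ, w₁ = 1 / ((2 * G * C₃) ^ 2 * (C₁ * C₂)) := ⟨_, rfl⟩
  have hw₁0 : 0 < w₁ := by rw [hw₁]; positivity
  obtain ⟨wh, hwh⟩ : ∃ wh : ℝ, wh = C₁ * (2 * M ^ 2) := ⟨_, rfl⟩
  have hwh0 : 0 ≤ wh := by rw [hwh]; positivity
  obtain ⟨T₁, hT₁⟩ : ∃ T₁ : ℝ, T₁ = 2 * wh / w₁ / (k / C₁) := ⟨_, rfl⟩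
  have hT₁0 : 0 ≤ T₁ := by rw [hT₁]; positivity
  obtain ⟨w₂, hw₂⟩ : ∃ w₂ : ℝ, w₂ = c₁ * c ^ 2 * exp (-(C₁ / c₁) * T₁) / 2 := ⟨_, rfl⟩
  have hw₂0 : 0 < w₂ := by rw [hw₂]; positivity
  obtain ⟨η, hη1, hη2, hη3, hη4, hηb, hη0⟩ :=
    ((eventually_const_mul_lt (C₁ / (k / C₁)) (half_pos hw₁0)).and <|
      (eventually_const_mul_lt (C₁ / (k / C₁)) hw₂0).and <|
      (eventually_const_mul_lt (C₁ / (C₁ / c₁)) hw₂0).and <|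
      (eventually_const_mul_lt 1 hw₂0).and <| (hbound (T₁ + S) (by positivity)).and
      self_mem_nhdsWithin).exists
  replace hη0 : 0 < η := hη0
  rw [div_mul_eq_mul_div] at hη1 hη2 hη3
  rw [one_mul] at hη4
  refine ⟨T₁ + S, η, exp (-(A / 2 * S)) * (G * C₃ * w₂) / ω, by positivity, hη0, by positivity,
    fun x y μ hx hy hμ hcx hxM hyM => ?_⟩
  have hB' := hηb x y μ hx hy hμ (abs_le.2 ⟨by linarith, hxM⟩) hyM
  have hle0 : (0 : ℝ) ∈ Icc 0 (T₁ + S) := ⟨le_rfl, by positivity⟩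
  set W : ℝ → ℝ := fun t => A * (exp (x t) - 1 - x t) + p * θ * (exp (y t) - 1 - y t) +
    ε * (x t * y t) with hW
  set W' : ℝ → ℝ := fun t => -(A ^ 2 * (exp (x t) - 1) ^ 2) +
    μ t * θ * exp (y t) * (θ * (exp (y t) - 1) - A * (exp (x t) - 1)) +
    ε * (y t * (A * (1 - exp (x t)) + θ * (1 - exp (y t)) - θ * μ t * exp (y t)) +
      x t * (A / p * (exp (x t) - 1) + μ t * θ * exp (y t) / p)) with hW'
  have hWd : ∀ t ∈ Icc 0 (T₁ + S), HasDerivAt W (W' t) t := fun t ht => by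
    refine ((((hx t ht).exp.sub_const 1).sub (hx t ht)).const_mul A |>.add
      ((((hy t ht).exp.sub_const 1).sub (hy t ht)).const_mul (p * θ)) |>.add
      (((hx t ht).mul (hy t ht)).const_mul ε)).congr_deriv ?_
    simp only [hW']
    field_simp; ring
  have hWbd : ∀ t ∈ Icc 0 (T₁ + S), c₁ * (x t ^ 2 + y t ^ 2) ≤ W t ∧
      W t ≤ C₁ * (x t ^ 2 + y t ^ 2) ∧ W' t ≤ -(k / C₁) * W t + C₁ * η ∧
      -(C₁ / c₁) * W t - C₁ * η ≤ W' t := fun t ht => by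
    obtain ⟨h1, h2, h3, h4⟩ := hlyap (x t) (y t) (μ t) (hB' t ht).1 (hB' t ht).2
    have h5 := mul_le_mul_of_nonneg_left (hμ t ht) hC₁.le
    refine ⟨h1, h2, h3.trans ?_, le_trans ?_ h4⟩
    · have : k / C₁ * W t ≤ k / C₁ * (C₁ * (x t ^ 2 + y t ^ 2)) := by gcongr
      have e : k / C₁ * (C₁ * (x t ^ 2 + y t ^ 2)) = k * (x t ^ 2 + y t ^ 2) := by field_simp
      linarith
    · have : C₁ / c₁ * (c₁ * (x t ^ 2 + y t ^ 2)) ≤ C₁ / c₁ * W t := by gcongr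
      have e : C₁ / c₁ * (c₁ * (x t ^ 2 + y t ^ 2)) = C₁ * (x t ^ 2 + y t ^ 2) := by field_simp
      linarith
  have hT₁mem : T₁ ∈ Icc 0 (T₁ + S) := ⟨hT₁0, by linarith⟩
  have hupper := le_of_deriv_le_neg_mul_add (by positivity : 0 < k / C₁)
    (by positivity : 0 ≤ C₁ * η) hWd (fun t ht => (hWbd t ht).2.2.1) T₁ hT₁mem
  have hlower := le_of_deriv_le_neg_mul_add (W := fun t => -W t) (W' := fun t => -W' t)
    (by positivity : 0 < C₁ / c₁) (by positivity : 0 ≤ C₁ * η) (fun t ht => (hWd t ht).neg)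
    (fun t ht => by linarith [(hWbd t ht).2.2.2]) T₁ hT₁mem
  rw [sub_zero] at hupper hlower
  have hx0sq : x 0 ^ 2 ≤ M ^ 2 := by gcongr; linarith
  have hy0sq : y 0 ^ 2 ≤ M ^ 2 := by rw [← sq_abs (y 0)]; gcongr
  have hW0u : W 0 ≤ wh := by
    refine (hWbd 0 hle0).2.1.trans ?_
    rw [hwh]; gcongr; linarith
  have hW0l : c₁ * c ^ 2 ≤ W 0 := by
    refine le_trans ?_ (hWbd 0 hle0).1
    gcongr
    have : c ^ 2 ≤ x 0 ^ 2 := by gcongr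
    linarith [sq_nonneg (y 0)]
  have hWT₁u : W T₁ ≤ w₁ := by
    have h1 : W 0 * exp (-(k / C₁) * T₁) ≤ w₁ / 2 := by
      have e1 : k / C₁ * T₁ = 2 * wh / w₁ := by rw [hT₁]; field_simp
      have h2 : 1 + 2 * wh / w₁ ≤ exp (k / C₁ * T₁) := by
        rw [e1, add_comm]; exact add_one_le_exp _
      rw [neg_mul, exp_neg, ← div_eq_mul_inv, div_le_iff₀ (exp_pos _)]
      calc W 0 ≤ wh := hW0u
        _ ≤ w₁ / 2 * (1 + 2 * wh / w₁) := by
          have : w₁ / 2 * (1 + 2 * wh / w₁) = w₁ / 2 + wh := by field_simp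
          rw [this]; linarith
        _ ≤ _ := by gcongr
    linarith
  have hWT₁l : w₂ ≤ W T₁ := by
    have h1 : 2 * w₂ ≤ W 0 * exp (-(C₁ / c₁) * T₁) := by
      have : 2 * w₂ = c₁ * c ^ 2 * exp (-(C₁ / c₁) * T₁) := by rw [hw₂]; ring
      rw [this]; gcongr
    linarith
  have hsub : ∀ t ∈ Icc T₁ (T₁ + S), t ∈ Icc 0 (T₁ + S) := fun t ht => ⟨hT₁0.trans ht.1, ht.2⟩
  have hlate : ∀ t ∈ Icc T₁ (T₁ + S), W t ≤ 2 * W T₁ := fun t ht => by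
    have h1 := le_of_deriv_le_neg_mul_add (by positivity : 0 < k / C₁)
      (by positivity : 0 ≤ C₁ * η) (fun s hs => hWd s (hsub s hs))
      (fun s hs => (hWbd s (hsub s hs)).2.2.1) t ht
    have h2 : exp (-(k / C₁) * (t - T₁)) ≤ 1 := by
      rw [exp_le_one_iff, neg_mul, neg_nonpos]
      have : 0 ≤ t - T₁ := by linarith [ht.1]
      positivity
    have h3 : W T₁ * exp (-(k / C₁) * (t - T₁)) ≤ W T₁ * 1 := by gcongr; linarith
    linarith
  set z : ℝ → ℝ := fun t => x t + p * y t with hz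
  set v : ℝ → ℝ := fun t => θ * (1 - exp (y t)) + A / 2 * (x t + p * y t) with hv
  set y' : ℝ → ℝ := fun t => A / p * (exp (x t) - 1) + μ t * θ * exp (y t) / p with hy'
  have hzd : ∀ t ∈ Icc 0 (T₁ + S), HasDerivAt z (θ * (1 - exp (y t))) t := fun t ht => by
    refine ((hx t ht).add ((hy t ht).const_mul p)).congr_deriv ?_
    field_simp; ring
  have hvd : ∀ t ∈ Icc 0 (T₁ + S), HasDerivAt v
      (-θ * exp (y t) * y' t + A / 2 * (θ * (1 - exp (y t)))) t := fun t ht => by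
    refine (((((hy t ht).exp.const_sub 1)).const_mul θ).add
      ((hzd t ht).const_mul (A / 2))).congr_deriv ?_
    ring
  set Z : ℝ → ℂ := fun t => (ω * z t : ℝ) + (v t : ℝ) * Complex.I with hZ
  have hnormsq : ∀ t, ‖Z t‖ ^ 2 = (ω * z t) ^ 2 + v t ^ 2 := fun t => by
    rw [Complex.sq_norm, hZ, Complex.normSq_add_mul_I]
  have hZd : ∀ t ∈ Icc 0 (T₁ + S), HasDerivAt Z ((ω * (θ * (1 - exp (y t))) : ℝ) +
      (-θ * exp (y t) * y' t + A / 2 * (θ * (1 - exp (y t))) : ℝ) * Complex.I) t := fun t ht =>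
    (((hzd t ht).const_mul ω).ofReal_comp).add ((hvd t ht).ofReal_comp.mul_const Complex.I)
  have hZT₁ : 2 * (G * C₃ * W T₁) ≤ ‖Z T₁‖ := by
    have hW0 : 0 < W T₁ := by linarith
    refine abs_le_of_sq_le_sq' ?_ (norm_nonneg _) |>.2
    rw [hnormsq]
    have h1 := (hspiral (x T₁) (y T₁) 0 (hB' _ hT₁mem).1 (hB' _ hT₁mem).2).1
    have h2 := (hWbd T₁ hT₁mem).2.1
    have h3 : W T₁ ≤ C₁ * C₂ * ((ω * z T₁) ^ 2 + v T₁ ^ 2) := by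
      refine h2.trans ?_
      rw [mul_assoc]; gcongr
    have h4 : (2 * (G * C₃ * W T₁)) ^ 2 * (C₁ * C₂) ≤ W T₁ := by
      have h5 : (2 * (G * C₃ * W T₁)) ^ 2 * (C₁ * C₂) = W T₁ * (W T₁ / w₁) := by
        rw [hw₁]; field_simp
      rw [h5]
      have : W T₁ / w₁ ≤ 1 := by rw [div_le_one hw₁0]; exact hWT₁u
      exact mul_le_of_le_one_right hW0.le this
    have h6 : 0 < C₁ * C₂ := by positivity
    refine le_of_mul_le_mul_right (h4.trans (h3.trans_eq (mul_comm _ _))) h6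
  have herr : ∀ t ∈ Icc T₁ (T₁ + S), ‖((ω * (θ * (1 - exp (y t))) : ℝ) : ℂ) +
        (-θ * exp (y t) * y' t + A / 2 * (θ * (1 - exp (y t))) : ℝ) * Complex.I +
        ((A / 2 : ℝ) + (ω : ℝ) * Complex.I) * Z t‖ ≤ C₃ * W T₁ := fun t ht => by
    have ht' := hsub t ht
    obtain ⟨-, h1⟩ := hspiral (x t) (y t) (μ t) (hB' _ ht').1 (hB' _ ht').2
    have e : ((ω * (θ * (1 - exp (y t))) : ℝ) : ℂ) +
        (-θ * exp (y t) * y' t + A / 2 * (θ * (1 - exp (y t))) : ℝ) * Complex.I +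
        ((A / 2 : ℝ) + (ω : ℝ) * Complex.I) * Z t =
        ((-θ * exp (y t) * y' t + A * (θ * (1 - exp (y t))) + A * θ / p * (x t + p * y t) : ℝ) : ℂ)
          * Complex.I := by
      have hκ : A * θ / p = ω ^ 2 + A ^ 2 / 4 := by rw [hωsq]; ring
      rw [hκ, hZ]
      simp only [hz, hv]
      push_cast
      linear_combination (ω : ℂ) * (θ * (1 - Complex.exp (y t)) + A / 2 * (x t + p * y t)) *
        Complex.I_sq
    rw [e, norm_mul, Complex.norm_I, mul_one, Complex.norm_real, Real.norm_eq_abs]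
    refine h1.trans ?_
    have h2 : C₂ * (x t ^ 2 + y t ^ 2) ≤ C₂ * (2 / c₁) * W T₁ := by
      rw [mul_assoc]
      gcongr
      rw [div_mul_eq_mul_div, le_div_iff₀ hc₁, mul_comm]
      exact (hWbd t ht').1.trans (hlate t ht)
    have h3 : C₂ * |μ t| ≤ C₂ * W T₁ := by
      gcongr; linarith [hμ t ht']
    have h4 : C₃ * W T₁ = C₂ * (2 / c₁) * W T₁ + C₂ * W T₁ := by rw [hC₃]; ring
    linarith
  have hsmall : exp (A / 2 * S) * (C₃ * W T₁) * S ≤ ‖Z T₁‖ / 2 := by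
    have : exp (A / 2 * S) * (C₃ * W T₁) * S = G * C₃ * W T₁ := by rw [hG]; ring
    linarith
  obtain ⟨τ, hτ, hτ'⟩ := exists_alternating_of_perturbed_rotation hA hω N (Z := Z) (a := T₁)
    (fun t ht => hZd t (hsub t (hS ▸ ht))) (fun t ht => herr t (hS ▸ ht)) (hS ▸ hsmall)
  rw [← hS] at hτ'
  refine ⟨τ, hτ, fun k hk => ⟨hsub _ (hτ' k hk).1, ?_⟩⟩
  have h1 := (hτ' k hk).2
  have h2 : (Z (τ k)).re = ω * z (τ k) := by simp [hZ]
  rw [h2] at h1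
  rw [div_le_iff₀ hω]
  have h3 : exp (-(A / 2 * S)) * (G * C₃ * w₂) ≤ exp (-(A / 2 * S)) * (‖Z T₁‖ / 2) := by
    have : G * C₃ * w₂ ≤ G * C₃ * W T₁ := by gcongr
    gcongr
    linarith
  calc _ ≤ _ := h3
    _ ≤ _ := h1
    _ = _ := by simp only [hz]; ring

theorem hasDerivAt_inverse_of_leftInvOn {f g : ℝ → ℝ} (hf : ContDiffOn ℝ 2 f (Ici 0))
    (hf' : ∀ u ∈ Ici (0 : ℝ), 0 < deriv f u) (hgf : ∀ u ∈ Ici (0 : ℝ), g (f u) = u) {u : ℝ}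
    (hu : 0 < u) : HasDerivAt g (deriv f u)⁻¹ (f u) := by
  have h1 : ContDiffAt ℝ 2 f u := hf.contDiffAt (Ici_mem_nhds hu)
  have h2 : HasStrictDerivAt f (deriv f u) u := h1.hasStrictDerivAt (by norm_num)
  refine (h2.to_local_left_inverse (hf' u hu.le).ne' ?_).hasDerivAt
  filter_upwards [Ioi_mem_nhds hu] with w hw using hgf w (mem_Ioi.1 hw).le

theorem differentiableAt_deriv_of_contDiffOn {f : ℝ → ℝ} (hf : ContDiffOn ℝ 2 f (Ici 0)) {u : ℝ}
    (hu : 0 < u) : DifferentiableAt ℝ (deriv f) u :=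
  (((hf.mono Ioi_subset_Ici_self).deriv_of_isOpen isOpen_Ioi (m := 1) (by norm_num)).contDiffAt
    (Ioi_mem_nhds hu)).differentiableAt (by norm_num)

theorem differentiableAt_deriv_inverse {f g : ℝ → ℝ} (hf : ContDiffOn ℝ 2 f (Ici 0))
    (hf' : ∀ u ∈ Ici (0 : ℝ), 0 < deriv f u) (hgf : ∀ u ∈ Ici (0 : ℝ), g (f u) = u) {u : ℝ}
    (hu : 0 < u) : DifferentiableAt ℝ (deriv g) (f u) := by
  have h1 : ContDiffAt ℝ 2 f u := hf.contDiffAt (Ici_mem_nhds hu)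
  have h2 : HasStrictDerivAt f (deriv f u) u := h1.hasStrictDerivAt (by norm_num)
  have hg := hasDerivAt_inverse_of_leftInvOn hf hf' hgf hu
  have h3 := differentiableAt_deriv_of_contDiffOn hf hu
  rw [← hgf u hu.le] at h3
  have h4 : DifferentiableAt ℝ (fun t => (deriv f (g t))⁻¹) (f u) :=
    (h3.comp (f u) hg.differentiableAt).inv (by
      rw [Function.comp_apply, hgf u hu.le]; exact (hf' u hu.le).ne')
  refine h4.congr_of_eventuallyEq ?_
  rw [EventuallyEq, ← h2.map_nhds_eq (hf' u hu.le).ne', eventually_map]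
  filter_upwards [Ioi_mem_nhds hu] with w hw
  rw [hgf w (mem_Ioi.1 hw).le, (hasDerivAt_inverse_of_leftInvOn hf hf' hgf hw).deriv]

theorem exists_ge_eq_of_tendsto_atTop {f : ℝ → ℝ} {U t : ℝ} (hf : ContinuousOn f (Ici U))
    (hftop : Tendsto f atTop atTop) (ht : f U ≤ t) : ∃ u, U ≤ u ∧ f u = t := by
  obtain ⟨V, hV, hUV⟩ := ((hftop.eventually_ge_atTop t).and (eventually_ge_atTop U)).exists
  obtain ⟨u, hu, rfl⟩ := intermediate_value_Icc hUV (hf.mono Icc_subset_Ici_self) ⟨ht, hV⟩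
  exact ⟨u, hu.1, rfl⟩

theorem tendsto_logDeriv_of_tendsto_mul_log {φ φ' : ℝ → ℝ} (hφ : ∀ᶠ t in atTop, 0 < φ t)
    (h1 : Tendsto φ' atTop (nhds 0))
    (h2 : Tendsto (fun t => φ' t / φ t * log (φ t)) atTop (nhds 0)) :
    Tendsto (fun t => φ' t / φ t) atTop (nhds 0) := by
  have h3 : Tendsto (fun t => |φ' t / φ t * log (φ t)| + exp 1 * |φ' t|) atTop (nhds 0) := by
    simpa using h2.abs.add (h1.abs.const_mul (exp 1))
  refine squeeze_zero_norm' ?_ h3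
  filter_upwards [hφ] with t ht
  rw [Real.norm_eq_abs]
  rcases le_or_gt 1 |log (φ t)| with h | h
  · have : |φ' t / φ t| * 1 ≤ |φ' t / φ t| * |log (φ t)| := by gcongr
    rw [abs_mul]
    have : 0 ≤ exp 1 * |φ' t| := by positivity
    linarith
  · have h4 : exp (-1) ≤ φ t := by
      rw [← le_log_iff_exp_le ht]; exact (abs_lt.1 h).1.le
    have h5 : |φ' t / φ t| ≤ exp 1 * |φ' t| := by
      rw [abs_div, abs_of_pos ht, div_le_iff₀ ht]
      calc |φ' t| = exp 1 * |φ' t| * exp (-1) := by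
            rw [mul_right_comm, ← exp_add]; simp
        _ ≤ _ := by gcongr
    linarith [abs_nonneg (φ' t / φ t * log (φ t))]

/-- If `φ t / φ (t + h t) → 1` for every `h = o(t)`, then `φ` is comparable to itself uniformly on
windows of bounded length. -/
theorem eventually_forall_Icc_le_two_mul {φ : ℝ → ℝ} (hφ : ∀ᶠ t in atTop, 0 < φ t)
    (h : ∀ h : ℝ → ℝ, (h =o[atTop] fun t : ℝ => t) →
      Tendsto (fun t => φ t / φ (t + h t)) atTop (nhds 1)) (S : ℝ) :
    ∀ᶠ t in atTop, ∀ τ ∈ Icc (t - S) t, φ t ≤ 2 * φ τ ∧ φ τ ≤ 2 * φ t := by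
  classical
  obtain ⟨P, hP⟩ : ∃ P : ℝ → ℝ → Prop, ∀ t τ, P t τ ↔
    τ ∈ Icc (t - S) t ∧ ¬(φ t ≤ 2 * φ τ ∧ φ τ ≤ 2 * φ t) := ⟨_, fun _ _ => Iff.rfl⟩
  obtain ⟨k, hk⟩ : ∃ k : ℝ → ℝ, ∀ t, |k t| ≤ |S| ∧ ((∃ τ, P t τ) → P t (t + k t)) := by
    refine ⟨fun t => if h : ∃ τ, P t τ then h.choose - t else 0, fun t => ?_⟩
    by_cases h : ∃ τ, P t τ
    · have h1 := h.choose_spec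
      simp only [h, dif_pos, add_sub_cancel, h1, implies_true, and_true]
      have h2 := ((hP _ _).1 h1).1
      rw [abs_sub_comm, abs_of_nonneg (by linarith [h2.2])]
      exact le_trans (by linarith [h2.1]) (le_abs_self S)
    · simp [h]
  have hko : k =o[atTop] fun t : ℝ => t := by
    have h1 : k =O[atTop] fun _ : ℝ => (1 : ℝ) :=
      isBigO_of_le' (c := |S|) _ fun t => by simpa using (hk t).1
    exact h1.trans_isLittleO (isLittleO_const_id_atTop (1 : ℝ))
  obtain ⟨t₀, ht₀⟩ := eventually_atTop.1 hφ
  filter_upwards [(h k hko).eventually (Ioo_mem_nhds (show (1 / 2 : ℝ) < 1 by norm_num)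
    (show (1 : ℝ) < 2 by norm_num)), eventually_ge_atTop (t₀ + |S|)] with t ht htS τ hτ
  by_contra hcon
  have h1 := (hk t).2 ⟨τ, (hP _ _).2 ⟨hτ, hcon⟩⟩
  have h2 := ((hP _ _).1 h1).2
  have h3 : 0 < φ (t + k t) := ht₀ _ (by linarith [(abs_le.1 (hk t).1).1])
  have h4 := (div_lt_iff₀ h3).1 ht.2
  have h5 := (lt_div_iff₀ h3).1 ht.1
  exact h2 ⟨h4.le, by linarith⟩

theorem eventually_of_forall_comp {f : ℝ → ℝ} {P : ℝ → Prop} (hf : ContinuousOn f (Ici 0))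
    (hftop : Tendsto f atTop atTop) (h : ∀ u, 0 < u → P (f u)) : ∀ᶠ t in atTop, P t := by
  filter_upwards [eventually_ge_atTop (f 1)] with t ht
  obtain ⟨u, hu, rfl⟩ :=
    exists_ge_eq_of_tendsto_atTop (hf.mono (Ici_subset_Ici.2 zero_le_one)) hftop ht
  exact h u (by linarith)

/-- On windows of length `S / f' ρ` below `ρ`, the function `f` varies by at most `2 S` and `f'` by
at most a factor two. -/
theorem eventually_forall_window {f g : ℝ → ℝ} (hf : ContDiffOn ℝ 2 f (Ici 0))
    (hf' : ∀ u ∈ Ici (0 : ℝ), 0 < deriv f u) (hftop : Tendsto f atTop atTop)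
    (hgf : ∀ u ∈ Ici (0 : ℝ), g (f u) = u)
    (h3 : ∀ h : ℝ → ℝ, (h =o[atTop] fun t : ℝ => t) →
      Tendsto (fun t => deriv g t / deriv g (t + h t)) atTop (nhds 1))
    {S : ℝ} (hS : 0 ≤ S) (U : ℝ) :
    ∀ᶠ ρ in atTop, ∀ u ∈ Icc (ρ - S / deriv f ρ) ρ,
      U ≤ u ∧ f ρ - 2 * S ≤ f u ∧ deriv f u ≤ 2 * deriv f ρ ∧ deriv f ρ ≤ 2 * deriv f u := by
  have hmono : StrictMonoOn f (Ici 0) :=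
    strictMonoOn_of_deriv_pos (convex_Ici 0) hf.continuousOn fun u hu =>
      hf' u (interior_subset hu)
  have hgd : ∀ u, 0 < u → HasDerivAt g (deriv f u)⁻¹ (f u) := fun u hu =>
    hasDerivAt_inverse_of_leftInvOn hf hf' hgf hu
  have hpos : ∀ᶠ t in atTop, 0 < deriv g t :=
    eventually_of_forall_comp hf.continuousOn hftop fun u hu => by
      rw [(hgd u hu).deriv]; exact inv_pos.2 (hf' u hu.le)
  filter_upwards [hftop.eventually (eventually_forall_Icc_le_two_mul hpos h3 (2 * S)),
    hftop.eventually_ge_atTop (f (max U 1) + 2 * S), eventually_ge_atTop 1] with ρ hρ hρU hρ1 u hu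
  have h1U : (0 : ℝ) < max U 1 := by positivity
  have hsurj : ∀ t, f (max U 1) ≤ t → ∃ u, max U 1 ≤ u ∧ f u = t := fun t ht =>
    exists_ge_eq_of_tendsto_atTop (hf.continuousOn.mono (Ici_subset_Ici.2 h1U.le)) hftop ht
  have hρ0 : 0 < ρ := by linarith
  obtain ⟨w, hw, hwρ⟩ := hsurj (f ρ - 2 * S) (by linarith)
  have hw0 : 0 < w := h1U.trans_le hw
  have hwρ' : w ≤ ρ := (hmono.le_iff_le hw0.le hρ0.le).1 (by linarith)
  have hdiff : S / deriv f ρ ≤ ρ - w := by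
    have hgdiff : ∀ t ∈ Icc (f ρ - 2 * S) (f ρ), HasDerivAt g (deriv g t) t := fun t ht => by
      obtain ⟨v, hv, rfl⟩ := hsurj t (by linarith [ht.1])
      exact (hgd v (h1U.trans_le hv)).differentiableAt.hasDerivAt
    have h4 := (convex_Icc (f ρ - 2 * S) (f ρ)).mul_sub_le_image_sub_of_le_deriv (f := g)
      (C := deriv g (f ρ) / 2) (fun t ht => (hgdiff t ht).continuousAt.continuousWithinAt)
      (fun t ht => (hgdiff t (interior_subset ht)).differentiableAt.differentiableWithinAt)
      (fun t ht => by linarith [(hρ t (interior_subset ht)).1]) (f ρ - 2 * S)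
      ⟨le_rfl, by linarith⟩ (f ρ) ⟨by linarith, le_rfl⟩ (by linarith)
    rw [← hwρ, hgf ρ hρ0.le, hgf w hw0.le, hwρ, (hgd ρ hρ0).deriv] at h4
    rw [div_eq_mul_inv]
    linarith
  have hwu : w ≤ u := by linarith [hu.1]
  have hu0 : 0 < u := hw0.trans_le hwu
  have hfu : f ρ - 2 * S ≤ f u := hwρ ▸ hmono.monotoneOn hw0.le hu0.le hwu
  have hfu' : f u ≤ f ρ := hmono.monotoneOn hu0.le hρ0.le hu.2
  obtain ⟨h5, h6⟩ := hρ (f u) ⟨hfu, hfu'⟩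
  have hρ' := hf' ρ hρ0.le
  have hu' := hf' u hu0.le
  rw [(hgd ρ hρ0).deriv, (hgd u hu0).deriv] at h5 h6
  refine ⟨(le_max_left _ _).trans (hw.trans hwu), hfu, ?_, ?_⟩
  · rw [← div_eq_mul_inv, inv_eq_one_div, div_le_div_iff₀ hρ' hu'] at h5
    linarith
  · rw [← div_eq_mul_inv, inv_eq_one_div, div_le_div_iff₀ hu' hρ'] at h6
    linarith

theorem hasDerivAt_exp_mul_deriv_inverse {f g : ℝ → ℝ} (hf : ContDiffOn ℝ 2 f (Ici 0))
    (hf' : ∀ u ∈ Ici (0 : ℝ), 0 < deriv f u) (hgf : ∀ u ∈ Ici (0 : ℝ), g (f u) = u) (q : ℝ) {u : ℝ}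
    (hu : 0 < u) : HasDerivAt (fun u => exp (-f u / q) * deriv g (f u))
      (exp (-f u / q) * (-(1 / q) + deriv (deriv g) (f u) / deriv g (f u))) u := by
  have h1 : HasDerivAt f (deriv f u) u :=
    ((hf.contDiffAt (Ici_mem_nhds hu)).differentiableAt (by norm_num)).hasDerivAt
  have h2 := (hasDerivAt_inverse_of_leftInvOn hf hf' hgf hu).deriv
  have h3 := (differentiableAt_deriv_inverse hf hf' hgf hu).hasDerivAt.comp u h1
  have h4 := hf' u hu.le
  refine (((h1.neg.div_const q).exp).mul h3).congr_deriv ?_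
  simp only [Function.comp_apply, h2, Pi.neg_apply]
  field_simp

theorem tendsto_exp_div_deriv {f g : ℝ → ℝ} (hf : ContDiffOn ℝ 2 f (Ici 0))
    (hf' : ∀ u ∈ Ici (0 : ℝ), 0 < deriv f u) (hftop : Tendsto f atTop atTop)
    (hgf : ∀ u ∈ Ici (0 : ℝ), g (f u) = u)
    (hκ : Tendsto (fun t => deriv (deriv g) t / deriv g t) atTop (nhds 0)) {p : ℝ} (hp : 0 < p) :
    Tendsto (fun u => exp (-f u / p) * deriv g (f u)) atTop (nhds 0) := by
  obtain ⟨U, hU⟩ := eventually_atTop.1 (((hκ.comp hftop).eventually (gt_mem_nhds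
    (show (0 : ℝ) < 1 / (2 * p) by positivity))).and (eventually_gt_atTop 0))
  have hder := fun u (hu : U ≤ u) =>
    hasDerivAt_exp_mul_deriv_inverse hf hf' hgf (2 * p) (hU u hu).2
  have hanti : AntitoneOn (fun u => exp (-f u / (2 * p)) * deriv g (f u)) (Ici U) :=
    antitoneOn_of_deriv_nonpos (convex_Ici U)
      (fun u hu => (hder u hu).continuousAt.continuousWithinAt)
      (fun u hu => (hder u (interior_subset hu)).differentiableAt.differentiableWithinAt)
      (fun u hu => by
        rw [(hder u (interior_subset hu)).deriv]
        have := (hU u (interior_subset hu)).1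
        simp only [Function.comp_apply] at this
        exact mul_nonpos_of_nonneg_of_nonpos (exp_pos _).le (by linarith))
  have h0 : Tendsto (fun u => exp (-f u / (2 * p)) * (exp (-f U / (2 * p)) * deriv g (f U))) atTop
      (nhds 0) := by
    have : Tendsto (fun u => -f u / (2 * p)) atTop atBot :=
      (tendsto_neg_atTop_atBot.comp hftop).atBot_div_const (by positivity)
    simpa using (tendsto_exp_atBot.comp this).mul_const (exp (-f U / (2 * p)) * deriv g (f U))
  refine squeeze_zero' ?_ ?_ h0
  · filter_upwards [eventually_gt_atTop 0] with u hu
    rw [(hasDerivAt_inverse_of_leftInvOn hf hf' hgf hu).deriv]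
    have := hf' u hu.le
    positivity
  · filter_upwards [eventually_ge_atTop U] with u hu
    have h1 := hanti self_mem_Ici hu hu
    calc exp (-f u / p) * deriv g (f u)
        = exp (-f u / (2 * p)) * (exp (-f u / (2 * p)) * deriv g (f u)) := by
          rw [← mul_assoc, ← exp_add]; congr 2; ring
      _ ≤ _ := by gcongr

/-- The tail integral of a positive integrable continuous function. -/
theorem hasDerivAt_integral_Ici {φ : ℝ → ℝ} {U u : ℝ} (hφ : IntegrableOn φ (Ioi U))
    (hc : ContinuousOn φ (Ioi U)) (hu : U < u) :
    HasDerivAt (fun u => ∫ s in Ici u, φ s) (-φ u) u := by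
  have h1 : HasDerivAt (fun w => (∫ s in Ioi u, φ s) - ∫ s in u..w, φ s) (-φ u) u := by
    refine HasDerivAt.congr_deriv ((intervalIntegral.integral_hasDerivAt_right (by simp)
      ?_ (hc.continuousAt (Ioi_mem_nhds hu))).const_sub _) rfl
    exact hc.stronglyMeasurableAtFilter isOpen_Ioi u hu
  refine h1.congr_of_eventuallyEq ?_
  filter_upwards [Ioi_mem_nhds hu] with w hw
  rw [integral_Ici_eq_integral_Ioi, eq_sub_iff_add_eq, add_comm]
  refine intervalIntegral.integral_interval_add_Ioi (hφ.mono_set (Ioi_subset_Ioi hu.le))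
    (hφ.mono_set (Ioi_subset_Ioi (mem_Ioi.1 hw).le))

theorem tendsto_integral_Ici {φ : ℝ → ℝ} {U : ℝ} (hφ : IntegrableOn φ (Ioi U)) :
    Tendsto (fun u => ∫ s in Ici u, φ s) atTop (nhds 0) := by
  have h1 := (intervalIntegral_tendsto_integral_Ioi U hφ tendsto_id).const_sub (∫ s in Ioi U, φ s)
  rw [sub_self] at h1
  refine h1.congr' ?_
  filter_upwards [eventually_ge_atTop U] with w hw
  rw [integral_Ici_eq_integral_Ioi, sub_eq_iff_eq_add', id]
  exact (intervalIntegral.integral_interval_add_Ioi hφ (hφ.mono_set (Ioi_subset_Ioi hw))).symm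

theorem integral_Ici_pos {φ : ℝ → ℝ} {U u : ℝ} (hφ : IntegrableOn φ (Ioi U))
    (hpos : ∀ s, 0 < φ s) (hu : U < u) : 0 < ∫ s in Ici u, φ s := by
  rw [integral_Ici_eq_integral_Ioi,
    setIntegral_pos_iff_support_of_nonneg_ae (Eventually.of_forall fun s => (hpos s).le)
      (hφ.mono_set (Ioi_subset_Ioi hu.le))]
  have : Function.support φ = univ := by ext s; simp [(hpos s).ne']
  simp [this]

theorem integrableOn_exp_neg_div {f g : ℝ → ℝ} (hf : ContDiffOn ℝ 2 f (Ici 0))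
    (hf' : ∀ u ∈ Ici (0 : ℝ), 0 < deriv f u) (hftop : Tendsto f atTop atTop)
    (hgf : ∀ u ∈ Ici (0 : ℝ), g (f u) = u)
    (hκ : Tendsto (fun t => deriv (deriv g) t / deriv g t) atTop (nhds 0)) {p : ℝ} (hp : 0 < p) :
    ∃ U, 0 < U ∧ IntegrableOn (fun u => exp (-f u / p)) (Ioi U) := by
  obtain ⟨U, hU⟩ := eventually_atTop.1 (((hκ.comp hftop).eventually (gt_mem_nhds
    (show (0 : ℝ) < 1 / (2 * p) by positivity))).and (eventually_gt_atTop 0))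
  have hder := fun u (hu : U ≤ u) => hasDerivAt_exp_mul_deriv_inverse hf hf' hgf p (hU u hu).2
  have hU0 := (hU U le_rfl).2
  have hκ' : ∀ u, U < u → -(1 / p) + deriv (deriv g) (f u) / deriv g (f u) ≤ -(1 / (2 * p)) :=
    fun u hu => by
      have := (hU u hu.le).1
      simp only [Function.comp_apply] at this
      have e : 1 / p = 1 / (2 * p) + 1 / (2 * p) := by field_simp; norm_num
      linarith
  have hc : 0 < 1 / (2 * p) := by positivity
  have hint := integrableOn_Ioi_deriv_of_nonpos' (fun u hu => hder u hu)
    (fun u hu => mul_nonpos_of_nonneg_of_nonpos (exp_pos _).le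
      ((hκ' u hu).trans (by linarith)))
    (tendsto_exp_div_deriv hf hf' hftop hgf hκ hp)
  refine ⟨U, hU0, (hint.const_mul (-(2 * p))).mono' ?_ ?_⟩
  · exact ContinuousOn.aestronglyMeasurable (((hf.continuousOn.mono fun u (hu : U < u) =>
      (hU0.trans hu).le).neg.div_const p).rexp) measurableSet_Ioi
  · refine (ae_restrict_iff' measurableSet_Ioi).2 (Eventually.of_forall fun u hu => ?_)
    rw [norm_of_nonneg (exp_pos _).le]
    have h1 := mul_le_mul_of_nonneg_left (hκ' u hu) (by positivity : 0 ≤ 2 * p * exp (-f u / p))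
    have h2 : 2 * p * exp (-f u / p) * -(1 / (2 * p)) = -exp (-f u / p) := by field_simp
    linarith

/-- The tail integral of `exp (-f / p)` is asymptotic to `p exp (-f / p) / f'`. -/
theorem tendsto_integral_mul_deriv_mul_exp {f g : ℝ → ℝ} (hf : ContDiffOn ℝ 2 f (Ici 0))
    (hf' : ∀ u ∈ Ici (0 : ℝ), 0 < deriv f u) (hftop : Tendsto f atTop atTop)
    (hgf : ∀ u ∈ Ici (0 : ℝ), g (f u) = u)
    (hκ : Tendsto (fun t => deriv (deriv g) t / deriv g t) atTop (nhds 0)) {p : ℝ} (hp : 0 < p) :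
    Tendsto (fun u => (∫ s in Ici u, exp (-f s / p)) * deriv f u * exp (f u / p) / p) atTop
      (nhds 1) := by
  obtain ⟨U, hU0, hint⟩ := integrableOn_exp_neg_div hf hf' hftop hgf hκ hp
  have hcont : ContinuousOn (fun u => exp (-f u / p)) (Ioi U) :=
    ((hf.continuousOn.mono fun u (hu : U < u) => (hU0.trans hu).le).neg.div_const p).rexp
  have hκ1 : Tendsto (fun u => -(1 / p) + deriv (deriv g) (f u) / deriv g (f u)) atTop
      (nhds (-(1 / p))) := by
    simpa using (hκ.comp hftop).const_add (-(1 / p))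
  have hneg : -(1 / p) < 0 := by rw [neg_lt_zero]; positivity
  have h1 : Tendsto (fun u => (∫ s in Ici u, exp (-f s / p)) /
      (exp (-f u / p) * deriv g (f u))) atTop (nhds p) := by
    refine HasDerivAt.lhopital_zero_atTop (f' := fun u => -exp (-f u / p))
      (g' := fun u => exp (-f u / p) * (-(1 / p) + deriv (deriv g) (f u) / deriv g (f u)))
      ?_ ?_ ?_ (tendsto_integral_Ici hint) (tendsto_exp_div_deriv hf hf' hftop hgf hκ hp) ?_
    · filter_upwards [eventually_gt_atTop U] with u hu using hasDerivAt_integral_Ici hint hcont hu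
    · filter_upwards [eventually_gt_atTop 0] with u hu using
        hasDerivAt_exp_mul_deriv_inverse hf hf' hgf p hu
    · filter_upwards [hκ1.eventually (gt_mem_nhds hneg)] with u hu
      exact mul_ne_zero (exp_pos _).ne' hu.ne
    · have h2 := (hκ1.inv₀ hneg.ne).neg
      have e : -(-(1 / p))⁻¹ = p := by field_simp
      rw [e] at h2
      refine h2.congr fun u => ?_
      rw [neg_div, div_mul_cancel_left₀ (exp_pos _).ne']
  have h3 := h1.div_const p
  rw [div_self hp.ne'] at h3
  refine h3.congr' ?_
  filter_upwards [eventually_gt_atTop 0] with u hu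
  rw [(hasDerivAt_inverse_of_leftInvOn hf hf' hgf hu).deriv, neg_div, exp_neg]
  have := hf' u hu.le
  field_simp

/-- The elementary integral behind the a priori bound for regular solutions. -/
theorem integral_rpow_mul_le {γ κ a : ℝ} {φ : ℝ → ℝ} {t : ℝ} (hκ : 0 < κ) (hγ : γ = κ - 1)
    (ht : 0 ≤ t) (hφ : ∀ s ∈ Ioo 0 t, φ s ≤ a) :
    ∫ s in (0 : ℝ)..t, s ^ γ * exp (φ s) ≤ exp a * (t ^ κ / κ) := by
  have h1 : -1 < γ := by linarith
  have h2 : ∫ s in (0 : ℝ)..t, s ^ γ * exp a = exp a * (t ^ κ / κ) := by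
    rw [intervalIntegral.integral_mul_const, integral_rpow (Or.inl h1), hγ, sub_add_cancel,
      zero_rpow hκ.ne', sub_zero, mul_comm]
  rw [← h2]
  refine (le_norm_self _).trans (intervalIntegral.norm_integral_le_of_norm_le ht ?_
    ((intervalIntegral.intervalIntegrable_rpow' h1).mul_const _))
  filter_upwards [compl_mem_ae_iff.2 (measure_singleton (μ := (volume : Measure ℝ)) t)] with s hs hst
  have h0 : 0 ≤ s ^ γ := rpow_nonneg hst.1.le _
  rw [norm_of_nonneg (by positivity)]
  gcongr
  exact hφ s ⟨hst.1, lt_of_le_of_ne hst.2 hs⟩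

theorem outer_integrand_le {α γ κ p θ a t : ℝ} {φ : ℝ → ℝ} (hp : 0 < p) (hκ : 0 < κ)
    (hγ : γ = κ - 1) (hα : κ - α = θ - p) (ht : 0 < t) (hφ : ∀ s ∈ Ioo 0 t, φ s ≤ a) :
    ‖t ^ (-(α / p)) * (∫ s in (0 : ℝ)..t, s ^ γ * exp (φ s)) ^ (1 / p)‖ ≤
      t ^ (θ / p - 1) * (κ ^ (-(1 / p)) * exp (a / p)) := by
  have h0 : 0 ≤ t ^ (-(α / p)) := rpow_nonneg ht.le _
  have h3 : 0 ≤ ∫ s in (0 : ℝ)..t, s ^ γ * exp (φ s) :=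
    intervalIntegral.integral_nonneg ht.le fun s hs =>
      mul_nonneg (rpow_nonneg hs.1 _) (exp_pos _).le
  have h4 := integral_rpow_mul_le hκ hγ ht.le hφ
  rw [norm_of_nonneg (by positivity)]
  calc t ^ (-(α / p)) * (∫ s in (0 : ℝ)..t, s ^ γ * exp (φ s)) ^ (1 / p)
      ≤ t ^ (-(α / p)) * (exp a * (t ^ κ / κ)) ^ (1 / p) := by gcongr
    _ = t ^ (θ / p - 1) * (κ ^ (-(1 / p)) * exp (a / p)) := by
      have h5 : 0 ≤ t ^ κ := rpow_nonneg ht.le _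
      rw [mul_rpow (exp_pos _).le (by positivity), div_rpow h5 hκ.le, ← rpow_mul ht.le,
        ← exp_mul, rpow_neg hκ.le]
      have h6 : t ^ (θ / p - 1) = t ^ (-(α / p)) * t ^ (κ * (1 / p)) := by
        rw [← rpow_add ht]; congr 1; field_simp; linarith
      rw [h6, mul_one_div]
      ring

theorem integral_outer_le {α γ κ p θ a r : ℝ} {φ : ℝ → ℝ} (hp : 0 < p) (hθ : 0 < θ) (hκ : 0 < κ)
    (hγ : γ = κ - 1) (hα : κ - α = θ - p) (hr : 0 ≤ r) (hφ : ∀ s ∈ Ioo 0 r, φ s ≤ a) :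
    ∫ t in (0 : ℝ)..r, t ^ (-(α / p)) * (∫ s in (0 : ℝ)..t, s ^ γ * exp (φ s)) ^ (1 / p) ≤
      κ ^ (-(1 / p)) * (p / θ) * (exp (a / p) * r ^ (θ / p)) := by
  have hθp : 0 < θ / p := by positivity
  have h1 : -1 < θ / p - 1 := by linarith
  have h2 : ∫ t in (0 : ℝ)..r, t ^ (θ / p - 1) * (κ ^ (-(1 / p)) * exp (a / p)) =
      κ ^ (-(1 / p)) * (p / θ) * (exp (a / p) * r ^ (θ / p)) := by
    rw [intervalIntegral.integral_mul_const, integral_rpow (Or.inl h1), sub_add_cancel,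
      zero_rpow hθp.ne', sub_zero]
    field_simp
  rw [← h2]
  exact (le_norm_self _).trans (intervalIntegral.norm_integral_le_of_norm_le hr
    (Eventually.of_forall fun t ht => outer_integrand_le hp hκ hγ hα ht.1
      fun s hs => hφ s ⟨hs.1, hs.2.trans_le ht.2⟩)
    ((intervalIntegral.intervalIntegrable_rpow' h1).mul_const _))

/-- As long as it stays in the region where `f` is monotone, the regular solution stays close to
its initial value. -/
theorem regular_solution_bounds {α γ κ p θ ρ U R : ℝ} {f v : ℝ → ℝ} (hp : 0 < p) (hθ : 0 < θ)
    (hκ : 0 < κ) (hγ : γ = κ - 1) (hα : κ - α = θ - p) (hf : MonotoneOn f (Ici U))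
    (hvc : ContinuousOn v (Ici 0))
    (hv : ∀ r, 0 ≤ r → v r = ρ - ∫ t in (0 : ℝ)..r, t ^ (-(α / p)) *
      (∫ s in (0 : ℝ)..t, s ^ γ * exp (f (v s))) ^ (1 / p))
    (hR : U < ρ - κ ^ (-(1 / p)) * (p / θ) * (exp (f ρ / p) * R ^ (θ / p))) :
    ∀ r ∈ Icc 0 R, ρ - κ ^ (-(1 / p)) * (p / θ) * (exp (f ρ / p) * r ^ (θ / p)) ≤ v r ∧
      v r ≤ ρ := by
  have hup : ∀ r, 0 ≤ r → v r ≤ ρ := fun r hr => by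
    rw [hv r hr, sub_le_self_iff]
    refine intervalIntegral.integral_nonneg hr fun t ht => ?_
    have : 0 ≤ ∫ s in (0 : ℝ)..t, s ^ γ * exp (f (v s)) :=
      intervalIntegral.integral_nonneg ht.1 fun s hs =>
        mul_nonneg (rpow_nonneg hs.1 _) (exp_pos _).le
    exact mul_nonneg (rpow_nonneg ht.1 _) (rpow_nonneg this _)
  have hlow : ∀ r ∈ Icc 0 R, (∀ s ∈ Ioo 0 r, U ≤ v s) →
      ρ - κ ^ (-(1 / p)) * (p / θ) * (exp (f ρ / p) * r ^ (θ / p)) ≤ v r := fun r hr h => by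
    rw [hv r hr.1]
    have := integral_outer_le (φ := fun s => f (v s)) (a := f ρ) hp hθ hκ hγ hα hr.1 fun s hs =>
      hf (h s hs) ((h s hs).trans (hup s hs.1.le)) (hup s hs.1.le)
    linarith
  have hmono : ∀ r ∈ Icc 0 R,
      U < ρ - κ ^ (-(1 / p)) * (p / θ) * (exp (f ρ / p) * r ^ (θ / p)) := fun r hr => by
    refine hR.trans_le ?_
    have := hr.1
    have := hr.2
    gcongr
  have hU : ∀ r ∈ Icc 0 R, U < v r := by
    by_contra! hcon
    obtain ⟨r₀, hr₀, hvr₀⟩ := hcon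
    have hcl : IsCompact (Icc 0 R ∩ v ⁻¹' Iic U) :=
      isCompact_Icc.of_isClosed_subset ((hvc.mono Icc_subset_Ici_self).preimage_isClosed_of_isClosed
        isClosed_Icc isClosed_Iic) inter_subset_left
    obtain ⟨r₁, ⟨hr₁, hvr₁⟩, hleast⟩ := hcl.exists_isLeast ⟨r₀, hr₀, hvr₀⟩
    have h1 := hlow r₁ hr₁ fun s hs => by
      by_contra! hs'
      exact (hleast ⟨⟨hs.1.le, hs.2.le.trans hr₁.2⟩, hs'.le⟩).not_gt hs.2
    exact absurd (mem_Iic.1 hvr₁) (not_le.2 ((hmono r₁ hr₁).trans_le h1))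
  exact fun r hr => ⟨hlow r hr fun s hs => (hU s ⟨hs.1.le, hs.2.le.trans hr.2⟩).le, hup r hr.1⟩

theorem intervalIntegrable_rpow_mul_exp {γ R t : ℝ} {φ : ℝ → ℝ} (hγ : -1 < γ)
    (hφ : ContinuousOn φ (Icc 0 R)) (ht : t ∈ Icc 0 R) :
    IntervalIntegrable (fun s => s ^ γ * exp (φ s)) volume 0 t :=
  (intervalIntegral.intervalIntegrable_rpow' hγ).mul_continuousOn
    ((hφ.mono (by rw [uIcc_of_le ht.1]; exact Icc_subset_Icc_right ht.2)).rexp)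

theorem hasDerivAt_integral_rpow_mul_exp {γ R t : ℝ} {φ : ℝ → ℝ} (hγ : -1 < γ)
    (hφ : ContinuousOn φ (Icc 0 R)) (ht : t ∈ Ioo 0 R) :
    HasDerivAt (fun t => ∫ s in (0 : ℝ)..t, s ^ γ * exp (φ s)) (t ^ γ * exp (φ t)) t := by
  have hc : ContinuousOn (fun s => s ^ γ * exp (φ s)) (Ioo 0 R) :=
    (continuousOn_id.rpow_const fun s hs => Or.inl (ne_of_gt hs.1)).mul
      (hφ.mono Ioo_subset_Icc_self).rexp
  exact intervalIntegral.integral_hasDerivAt_right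
    (intervalIntegrable_rpow_mul_exp hγ hφ ⟨ht.1.le, ht.2.le⟩)
    (hc.stronglyMeasurableAtFilter isOpen_Ioo t ht) (hc.continuousAt (Ioo_mem_nhds ht.1 ht.2))

theorem le_integral_rpow_mul_exp {γ κ a R t : ℝ} {φ : ℝ → ℝ} (hκ : 0 < κ) (hγ : γ = κ - 1)
    (hφ : ContinuousOn φ (Icc 0 R)) (ht : t ∈ Icc 0 R) (ha : ∀ s ∈ Ioo 0 t, a ≤ φ s) :
    exp a * (t ^ κ / κ) ≤ ∫ s in (0 : ℝ)..t, s ^ γ * exp (φ s) := by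
  have h1 : -1 < γ := by linarith
  have h2 : ∫ s in (0 : ℝ)..t, s ^ γ * exp a = exp a * (t ^ κ / κ) := by
    rw [intervalIntegral.integral_mul_const, integral_rpow (Or.inl h1), hγ, sub_add_cancel,
      zero_rpow hκ.ne', sub_zero, mul_comm]
  rw [← h2]
  refine intervalIntegral.integral_mono_on_of_le_Ioo ht.1
    ((intervalIntegral.intervalIntegrable_rpow' h1).mul_const _)
    (intervalIntegrable_rpow_mul_exp h1 hφ ht) fun s hs => ?_
  have := rpow_nonneg hs.1.le γ
  have := ha s hs
  gcongr

theorem hasDerivAt_regular_solution {α γ κ p θ ρ R r : ℝ} {φ v : ℝ → ℝ} (hp : 0 < p) (hθ : 0 < θ)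
    (hκ : 0 < κ) (hγ : γ = κ - 1) (hα : κ - α = θ - p) (hφ : ContinuousOn φ (Icc 0 R))
    (hv : ∀ r, 0 ≤ r → v r = ρ - ∫ t in (0 : ℝ)..r, t ^ (-(α / p)) *
      (∫ s in (0 : ℝ)..t, s ^ γ * exp (φ s)) ^ (1 / p)) (hr : r ∈ Ioo 0 R) :
    HasDerivAt v (-(r ^ (-(α / p)) * (∫ s in (0 : ℝ)..r, s ^ γ * exp (φ s)) ^ (1 / p))) r := by
  have h1 : -1 < γ := by linarith
  have hθp : -1 < θ / p - 1 := by linarith [div_pos hθ hp]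
  obtain ⟨a, ha⟩ : ∃ a, ∀ s ∈ Icc 0 R, φ s ≤ a := by
    obtain ⟨a, ha⟩ := (isCompact_Icc.image_of_continuousOn hφ).bddAbove
    exact ⟨a, fun s hs => ha (mem_image_of_mem _ hs)⟩
  have hc : ContinuousOn (fun t => t ^ (-(α / p)) *
      (∫ s in (0 : ℝ)..t, s ^ γ * exp (φ s)) ^ (1 / p)) (Ioo 0 R) :=
    (continuousOn_id.rpow_const fun s hs => Or.inl (ne_of_gt hs.1)).mul
      (ContinuousOn.rpow_const (fun t ht =>
        (hasDerivAt_integral_rpow_mul_exp h1 hφ ht).continuousAt.continuousWithinAt)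
        fun t _ => Or.inr (by positivity))
  have hint : IntervalIntegrable (fun t => t ^ (-(α / p)) *
      (∫ s in (0 : ℝ)..t, s ^ γ * exp (φ s)) ^ (1 / p)) volume 0 r := by
    refine IntervalIntegrable.mono_fun'
      (g := fun t => t ^ (θ / p - 1) * (κ ^ (-(1 / p)) * exp (a / p)))
      ((intervalIntegral.intervalIntegrable_rpow' hθp).mul_const _) ?_ ?_
    · rw [uIoc_of_le hr.1.le]
      exact (hc.mono fun s hs => ⟨hs.1, hs.2.trans_lt hr.2⟩).aestronglyMeasurable measurableSet_Ioc
    · rw [uIoc_of_le hr.1.le]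
      refine (ae_restrict_iff' measurableSet_Ioc).2 (Eventually.of_forall fun t ht => ?_)
      exact outer_integrand_le hp hκ hγ hα ht.1 fun s hs =>
        ha s ⟨hs.1.le, hs.2.le.trans (ht.2.trans hr.2.le)⟩
  refine HasDerivAt.congr_of_eventuallyEq (f := fun r => ρ - ∫ t in (0 : ℝ)..r, t ^ (-(α / p)) *
      (∫ s in (0 : ℝ)..t, s ^ γ * exp (φ s)) ^ (1 / p)) ?_ ?_
  · exact (intervalIntegral.integral_hasDerivAt_right hint
      (hc.stronglyMeasurableAtFilter isOpen_Ioo r hr)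
      (hc.continuousAt (Ioo_mem_nhds hr.1 hr.2))).const_sub ρ
  · filter_upwards [Ioi_mem_nhds hr.1] with s hs using hv s (mem_Ioi.1 hs).le

/-- In logarithmic variables the equation becomes a perturbed Lotka-Volterra system. -/
theorem hasDerivAt_lotkaVolterra_coords {A θ p α γ ℓ t f' : ℝ} {f F v m : ℝ → ℝ} (hA : 0 < A)
    (hθ : 0 < θ) (hp : 0 < p) (hα : α = A + p) (hγ : γ = A + θ - 1)
    (hm : HasDerivAt m (exp (ℓ + t) ^ γ * exp (f (v (exp (ℓ + t))))) (exp (ℓ + t)))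
    (hv : HasDerivAt v (-(exp (ℓ + t) ^ (-(α / p)) * m (exp (ℓ + t)) ^ (1 / p))) (exp (ℓ + t)))
    (hm0 : 0 < m (exp (ℓ + t))) (hf : HasDerivAt f f' (v (exp (ℓ + t))))
    (hF : HasDerivAt F (-exp (-f (v (exp (ℓ + t))) / p)) (v (exp (ℓ + t))))
    (hF0 : 0 < F (v (exp (ℓ + t)))) {x y : ℝ → ℝ} {μ : ℝ}
    (hx : x = fun t => (A + θ) * (ℓ + t) + f (v (exp (ℓ + t))) - log (m (exp (ℓ + t))) - log A)
    (hy : y = fun t => -(A / p) * (ℓ + t) + log (m (exp (ℓ + t))) / p + log p -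
      f (v (exp (ℓ + t))) / p - log (F (v (exp (ℓ + t)))) - log θ)
    (hμ : μ = F (v (exp (ℓ + t))) * f' * exp (f (v (exp (ℓ + t))) / p) / p - 1) :
    HasDerivAt x (A * (1 - exp (x t)) + θ * (1 - exp (y t)) - θ * μ * exp (y t)) t ∧
      HasDerivAt y (A / p * (exp (x t) - 1) + μ * θ * exp (y t) / p) t := by
  have hR : HasDerivAt (fun t => exp (ℓ + t)) (exp (ℓ + t)) t := by
    simpa using ((hasDerivAt_id t).const_add ℓ).exp
  have hL : HasDerivAt (fun t => ℓ + t) 1 t := (hasDerivAt_id t).const_add ℓ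
  have hmt := (hm.comp t hR)
  have hvt := hv.comp t hR
  have hft := hf.comp t hvt
  have hFt := hF.comp t hvt
  have hex : exp (x t) * A * m (exp (ℓ + t)) =
      exp (ℓ + t) ^ γ * exp (f (v (exp (ℓ + t)))) * exp (ℓ + t) := by
    rw [hx, exp_sub, exp_sub, exp_log hm0, exp_log hA, ← exp_mul, ← exp_add, ← exp_add]
    field_simp
    congr 1
    rw [hγ]; ring
  have hey : exp (y t) * θ * F (v (exp (ℓ + t))) * exp (f (v (exp (ℓ + t))) / p) / p =
      exp (ℓ + t) ^ (-(α / p)) * m (exp (ℓ + t)) ^ (1 / p) * exp (ℓ + t) := by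
    have h1 : m (exp (ℓ + t)) ^ (1 / p) = exp (log (m (exp (ℓ + t))) / p) := by
      rw [rpow_def_of_pos hm0, mul_one_div]
    rw [h1, hy, exp_sub, exp_sub, exp_sub, exp_add _ (log p), exp_log hF0, exp_log hθ, exp_log hp,
      ← exp_mul, ← exp_add, ← exp_add]
    field_simp
    congr 1
    rw [hα]; field_simp; ring
  have hlm := hmt.log hm0.ne'
  have hlF := hFt.log hF0.ne'
  simp only [Function.comp_def] at hlm hlF hft
  have hlm' : exp (ℓ + t) ^ γ * exp (f (v (exp (ℓ + t)))) * exp (ℓ + t) / m (exp (ℓ + t)) =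
      A * exp (x t) := by
    rw [← hex]; field_simp
  have hft' : f' * (-(exp (ℓ + t) ^ (-(α / p)) * m (exp (ℓ + t)) ^ (1 / p)) * exp (ℓ + t)) =
      -(θ * (1 + μ) * exp (y t)) := by
    rw [neg_mul, ← hey, hμ]; field_simp; ring
  have hlF' : -exp (-f (v (exp (ℓ + t))) / p) *
      (-(exp (ℓ + t) ^ (-(α / p)) * m (exp (ℓ + t)) ^ (1 / p)) * exp (ℓ + t)) /
      F (v (exp (ℓ + t))) = θ * exp (y t) / p := by
    rw [neg_mul (exp (ℓ + t) ^ (-(α / p)) * m (exp (ℓ + t)) ^ (1 / p)), ← hey, neg_div, exp_neg]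
    field_simp
  rw [hlm'] at hlm
  rw [hlF'] at hlF
  rw [hft'] at hft
  constructor
  · have := ((hL.const_mul (A + θ)).add hft).sub hlm |>.sub_const (log A)
    refine (this.congr_of_eventuallyEq
      (Eventually.of_forall fun s => congrFun hx s)).congr_deriv ?_
    ring
  · have := ((((hL.const_mul (-(A / p))).add (hlm.div_const p)).add_const (log p)).sub
      (hft.div_const p)).sub hlF |>.sub_const (log θ)
    refine (this.congr_of_eventuallyEq
      (Eventually.of_forall fun s => congrFun hy s)).congr_deriv ?_
    field_simp
    ring

theorem lotkaVolterra_coords_add {A θ p ℓ : ℝ} {f F m : ℝ} (hA : 0 < A)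
    (hθ : 0 < θ) (hp : 0 < p) (hF : 0 < F) :
    ((A + θ) * ℓ + f - log m - log A) +
      p * (-(A / p) * ℓ + log m / p + log p - f / p - log F - log θ) =
    p * log (p / θ * A ^ (-(1 / p)) * exp ℓ ^ (θ / p) / F) := by
  have : 0 < A ^ (-(1 / p)) := by positivity
  have : 0 < exp ℓ ^ (θ / p) := by positivity
  rw [log_div (by positivity) hF.ne', log_mul (by positivity) (by positivity),
    log_mul (by positivity) (by positivity), log_div hp.ne' hθ.ne', log_rpow hA,
    log_rpow (exp_pos _), log_exp]
  field_simp
  ring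

theorem exists_finset_zeros_of_alternating {φ : ℝ → ℝ} {σ : ℕ → ℝ} {a b : ℝ} (N : ℕ)
    (hφ : ContinuousOn φ (Ioo a b)) (hσ : StrictMono σ)
    (h : ∀ k ≤ N, σ k ∈ Ioo a b ∧ 0 < (-1) ^ k * φ (σ k)) :
    ∃ t : Finset ℝ, t.card = N ∧ ∀ x ∈ t, x ∈ Ioo a b ∧ φ x = 0 := by
  have h1 : ∀ k : Fin N, ∃ x ∈ Ioo (σ k) (σ (k + 1)), x ∈ Ioo a b ∧ φ x = 0 := fun k => by
    obtain ⟨m1, p1⟩ := h k k.2.le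
    obtain ⟨m2, p2⟩ := h (k + 1) k.2
    have hle : σ k ≤ σ (k + 1) := (hσ (Nat.lt_succ_self _)).le
    have hsub : Icc (σ k) (σ (k + 1)) ⊆ Ioo a b := fun s hs =>
      ⟨m1.1.trans_le hs.1, hs.2.trans_lt m2.2⟩
    rw [pow_succ] at p2
    rcases neg_one_pow_eq_or ℝ (k : ℕ) with e | e
    · rw [e] at p1 p2
      obtain ⟨x, hx, hx0⟩ := intermediate_value_Ioo' hle (hφ.mono hsub)
        (show (0 : ℝ) ∈ Ioo (φ (σ (k + 1))) (φ (σ k)) from ⟨by linarith, by linarith⟩)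
      exact ⟨x, hx, hsub (Ioo_subset_Icc_self hx), hx0⟩
    · rw [e] at p1 p2
      obtain ⟨x, hx, hx0⟩ := intermediate_value_Ioo hle (hφ.mono hsub)
        (show (0 : ℝ) ∈ Ioo (φ (σ k)) (φ (σ (k + 1))) from ⟨by linarith, by linarith⟩)
      exact ⟨x, hx, hsub (Ioo_subset_Icc_self hx), hx0⟩
  choose ξ hξ hξ' using h1
  have hinj : StrictMono ξ := fun i j hij =>
    (hξ i).2.trans_le ((hσ.monotone (Nat.succ_le_of_lt hij)).trans (hξ j).1.le)
  refine ⟨Finset.univ.map ⟨ξ, hinj.injective⟩, by simp, fun x hx => ?_⟩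
  obtain ⟨k, -, rfl⟩ := Finset.mem_map.1 hx
  exact hξ' k

theorem abs_log_le_of_mem_Icc {a b w : ℝ} (ha : 0 < a) (hw : w ∈ Icc a b) :
    |log w| ≤ |log a| + |log b| := by
  have h1 := log_le_log ha hw.1
  have h2 := log_le_log (ha.trans_le hw.1) hw.2
  refine abs_le.2 ⟨?_, ?_⟩
  · linarith [neg_abs_le (log a), abs_nonneg (log b)]
  · linarith [le_abs_self (log b), abs_nonneg (log a)]

theorem mul_div_mem_Icc_of_window {k p D a b a' b' F : ℝ} (hk : 0 < k) (hp : 0 < p) (ha' : 0 < a')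
    (hb' : 0 < b') (hF : 0 < F) (h1 : a - D ≤ b) (h2 : b ≤ a) (h3 : b' ≤ 2 * a')
    (h4 : a' ≤ 2 * b') (h5 : 1 / 2 ≤ F * b' * exp (b / p) / p) (h6 : F * b' * exp (b / p) / p ≤ 2) :
    k * (exp (-a / p) / a') / F ∈ Icc (k * exp (-(D / p)) / (4 * p)) (4 * k / p) := by
  obtain ⟨Q, hQ⟩ : ∃ Q, Q = F * b' * exp (b / p) / p := ⟨_, rfl⟩
  rw [← hQ] at h5 h6
  have hQ0 : 0 < Q := by linarith
  have e : k * (exp (-a / p) / a') / F = k / p * exp ((b - a) / p) * (b' / a') / Q := by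
    have e1 : exp ((b - a) / p) = exp (-a / p) * exp (b / p) := by rw [← exp_add]; congr 1; ring
    rw [e1, hQ]; field_simp
  have r1 : 1 / 2 ≤ b' / a' := by rw [le_div_iff₀ ha']; linarith
  have r2 : b' / a' ≤ 2 := by rw [div_le_iff₀ ha']; linarith
  have e1 : exp (-(D / p)) ≤ exp ((b - a) / p) := by
    rw [exp_le_exp, ← neg_div]; gcongr; linarith
  have e2 : exp ((b - a) / p) ≤ 1 := by
    rw [exp_le_one_iff]; exact div_nonpos_of_nonpos_of_nonneg (by linarith) hp.le
  rw [e]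
  constructor
  · calc k * exp (-(D / p)) / (4 * p) = k / p * exp (-(D / p)) * (1 / 2) / 2 := by
          field_simp; norm_num
      _ ≤ _ := by gcongr
  · calc _ ≤ k / p * 1 * 2 / (1 / 2) := by gcongr
      _ = 4 * k / p := by field_simp; norm_num

set_option maxHeartbeats 1000000 in
/-- For large `ρ` the regular solution, measured through the tail integral of `exp (-f / p)`,
oscillates around the singular profile as often as prescribed. -/
theorem exists_alternating_regular_solution {A θ p α γ : ℝ} {f : ℝ → ℝ} (hA : 0 < A) (hθ : 0 < θ)
    (hp : 0 < p) (hα : α = A + p) (hγ : γ = A + θ - 1) (hdisc : A < 4 * θ / p)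
    (hf : ContDiffOn ℝ 2 f (Ici 0)) (hf' : ∀ u ∈ Ici (0 : ℝ), 0 < deriv f u) {F : ℝ → ℝ}
    (hF : ∀ᶠ u in atTop, HasDerivAt F (-exp (-f u / p)) u ∧ 0 < F u)
    (hQ : Tendsto (fun u => F u * deriv f u * exp (f u / p) / p) atTop (nhds 1))
    (hwin : ∀ S : ℝ, 0 ≤ S → ∀ U : ℝ, ∀ᶠ ρ in atTop, ∀ u ∈ Icc (ρ - S / deriv f ρ) ρ,
      U ≤ u ∧ f ρ - 2 * S ≤ f u ∧ deriv f u ≤ 2 * deriv f ρ ∧ deriv f ρ ≤ 2 * deriv f u)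
    (hh : Tendsto (fun u => exp (-f u / p) / deriv f u) atTop (nhds 0)) (N : ℕ) :
    ∃ d : ℝ, 0 < d ∧ ∀ U R : ℝ, 0 < R → ∀ᶠ ρ in atTop, ∀ v : ℝ → ℝ, ContinuousOn v (Ici 0) →
      (∀ r, 0 ≤ r → v r = ρ - ∫ t in (0 : ℝ)..r, t ^ (-(α / p)) *
        (∫ s in (0 : ℝ)..t, s ^ γ * exp (f (v s))) ^ (1 / p)) →
      ∃ σ : ℕ → ℝ, StrictMono σ ∧ ∀ k ≤ N, σ k ∈ Ioo 0 R ∧ U ≤ v (σ k) ∧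
        d ≤ (-1) ^ k *
          (p * log (p / θ * A ^ (-(1 / p)) * σ k ^ (θ / p) / F (v (σ k)))) := by
  have hκ : 0 < A + θ := by positivity
  obtain ⟨D, hD⟩ : ∃ D, 2 * D = log (A + θ) - log A := ⟨(log (A + θ) - log A) / 2, by ring⟩
  have hD0 : 0 < D := by linarith [log_lt_log hA (by linarith : A < A + θ)]
  obtain ⟨C, hC⟩ : ∃ C, C = (A + θ) ^ (-(1 / p)) * (p / θ) := ⟨_, rfl⟩
  have hC0 : 0 < C := by rw [hC]; positivity
  obtain ⟨s₀, hs₀⟩ : ∃ s₀, C * s₀ = D / 2 := ⟨D / 2 / C, by field_simp⟩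
  have hs₀0 : 0 < s₀ := pos_of_mul_pos_right (by rw [hs₀]; positivity) hC0.le
  obtain ⟨K, hK⟩ : ∃ K, K = p / θ * A ^ (-(1 / p)) := ⟨_, rfl⟩
  have hK0 : 0 < K := by rw [hK]; positivity
  obtain ⟨Z, hZ⟩ : ∃ Z, Z = p * (|log (K * s₀ * exp (-(D / p)) / (4 * p))| +
    |log (4 * (K * s₀) / p)|) := ⟨_, rfl⟩
  have hZ0 : 0 ≤ Z := by rw [hZ]; positivity
  obtain ⟨T, η, d, hT, hη, hd, hdyn⟩ := exists_alternating_of_perturbed_lotkaVolterra hA hθ hp hdisc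
    hD0 (M := 3 * D + (Z + 3 * D) / p) (by positivity) N
  refine ⟨d, hd, fun U R hR => ?_⟩
  obtain ⟨E, hE⟩ : ∃ E, E = exp ((T + 1) * (θ / p)) := ⟨_, rfl⟩
  have hE1 : 1 ≤ E := by rw [hE]; exact one_le_exp (by positivity)
  have hQη := hQ.eventually (Icc_mem_nhds (by linarith : 1 - η < 1) (by linarith : 1 < 1 + η))
  have hQ2 := hQ.eventually
    (Icc_mem_nhds (by norm_num : (1 / 2 : ℝ) < 1) (by norm_num : (1 : ℝ) < 2))
  obtain ⟨U₁, hU₁⟩ := eventually_atTop.1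
    ((hF.and hQη).and (hQ2.and ((eventually_gt_atTop 0).and (eventually_ge_atTop U))))
  have hU₁0 : 0 < U₁ := (hU₁ U₁ le_rfl).2.2.1
  have hmono : StrictMonoOn f (Ici 0) :=
    strictMonoOn_of_deriv_pos (convex_Ici 0) hf.continuousOn fun u hu =>
      hf' u (interior_subset hu)
  have hsmall : ∀ᶠ ρ in atTop, s₀ * (exp (-f ρ / p) / deriv f ρ) * E < R ^ (θ / p) := by
    have := (hh.const_mul s₀).mul_const E
    rw [mul_zero, zero_mul] at this
    exact this.eventually (gt_mem_nhds (by positivity))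
  filter_upwards [hwin (D / 2) (by positivity) U₁, hwin (D / 2 * E) (by positivity) (U₁ + 1), hsmall,
    eventually_gt_atTop 0] with ρ hw₀ hw₁ hρR hρ v hvc hv
  have hρ' := hf' ρ hρ.le
  obtain ⟨h, hhdef⟩ : ∃ h, h = exp (-f ρ / p) / deriv f ρ := ⟨_, rfl⟩
  rw [← hhdef] at hρR
  have hh0 : 0 < h := by rw [hhdef]; positivity
  obtain ⟨ℓ, hℓ⟩ : ∃ ℓ, ℓ = p / θ * log (s₀ * h) := ⟨_, rfl⟩
  have hpow : ∀ t, exp (ℓ + t) ^ (θ / p) = s₀ * h * exp (t * (θ / p)) := fun t => by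
    rw [← exp_mul, add_mul, exp_add, hℓ]
    congr 1
    rw [mul_right_comm, div_mul_div_cancel₀ hθ.ne', div_self hp.ne', one_mul,
      exp_log (by positivity)]
  have hdrop : ∀ t, C * (exp (f ρ / p) * exp (ℓ + t) ^ (θ / p)) =
      D / 2 * exp (t * (θ / p)) / deriv f ρ := fun t => by
    rw [hpow, hhdef, neg_div, exp_neg, ← hs₀]
    field_simp
  obtain ⟨Rm, hRm⟩ : ∃ Rm, Rm = exp (ℓ + (T + 1)) := ⟨_, rfl⟩
  have hRm0 : 0 < Rm := hRm ▸ exp_pos _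
  have hRmR : Rm < R := by
    rw [← rpow_lt_rpow_iff hRm0.le hR.le (by positivity : 0 < θ / p), hRm, hpow, ← hE]
    exact hρR
  have hα' : A + θ - α = θ - p := by rw [hα]; ring
  have hbds := regular_solution_bounds (U := U₁) (R := Rm) hp hθ hκ hγ hα'
    (hmono.monotoneOn.mono (Ici_subset_Ici.2 hU₁0.le)) hvc hv (by
      rw [← hC, hRm, hdrop, ← hE]
      have := (hw₁ _ ⟨le_rfl, by rw [sub_le_self_iff]; positivity⟩).1
      linarith)
  have hvw : ∀ t, t ≤ T + 1 → ∀ r ∈ Icc 0 (exp (ℓ + t)),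
      v r ∈ Icc (ρ - D / 2 * exp (t * (θ / p)) / deriv f ρ) ρ := fun t ht r hr => by
    have hrm : exp (ℓ + t) ≤ Rm := by rw [hRm, exp_le_exp]; linarith
    obtain ⟨h1, h2⟩ := hbds r ⟨hr.1, hr.2.trans hrm⟩
    refine ⟨le_trans ?_ h1, h2⟩
    rw [← hC, ← hdrop]
    have := hr.1
    have := hr.2
    gcongr
  have hvU : ∀ r ∈ Icc 0 Rm, U₁ ≤ v r := fun r hr => by
    have := (hw₁ (v r) (by rw [hE]; exact hvw (T + 1) le_rfl r (hRm ▸ hr))).1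
    linarith
  have hφ : ContinuousOn (fun s => f (v s)) (Icc 0 Rm) :=
    hf.continuousOn.comp (hvc.mono Icc_subset_Ici_self) fun s hs => hU₁0.le.trans (hvU s hs)
  obtain ⟨m, hm⟩ : ∃ m : ℝ → ℝ, m = fun t => ∫ s in (0 : ℝ)..t, s ^ γ * exp (f (v s)) := ⟨_, rfl⟩
  have hγ1 : -1 < γ := by linarith
  have hmem : ∀ t ∈ Icc 0 T, exp (ℓ + t) ∈ Ioo 0 Rm := fun t ht =>
    ⟨exp_pos _, by rw [hRm, exp_lt_exp]; linarith [ht.2]⟩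
  have hmpos : ∀ t ∈ Icc 0 T, 0 < m (exp (ℓ + t)) := fun t ht => by
    rw [hm]
    refine lt_of_lt_of_le ?_ (le_integral_rpow_mul_exp (a := f U₁) hκ hγ hφ
      (Ioo_subset_Icc_self (hmem t ht)) fun s hs => ?_)
    · positivity
    · have := hvU s ⟨hs.1.le, hs.2.le.trans (hmem t ht).2.le⟩
      exact hmono.monotoneOn hU₁0.le (hU₁0.le.trans this) this
  obtain ⟨x, hx⟩ : ∃ x : ℝ → ℝ, x = fun t => (A + θ) * (ℓ + t) + f (v (exp (ℓ + t))) -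
    log (m (exp (ℓ + t))) - log A := ⟨_, rfl⟩
  obtain ⟨y, hy⟩ : ∃ y : ℝ → ℝ, y = fun t => -(A / p) * (ℓ + t) + log (m (exp (ℓ + t))) / p +
    log p - f (v (exp (ℓ + t))) / p - log (F (v (exp (ℓ + t)))) - log θ := ⟨_, rfl⟩
  obtain ⟨μ, hμ⟩ : ∃ μ : ℝ → ℝ, μ = fun t => F (v (exp (ℓ + t))) * deriv f (v (exp (ℓ + t))) *
    exp (f (v (exp (ℓ + t))) / p) / p - 1 := ⟨_, rfl⟩
  have hUt : ∀ t ∈ Icc 0 T, U₁ ≤ v (exp (ℓ + t)) := fun t ht =>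
    hvU _ (Ioo_subset_Icc_self (hmem t ht))
  have hode : ∀ t ∈ Icc 0 T,
      HasDerivAt x (A * (1 - exp (x t)) + θ * (1 - exp (y t)) - θ * μ t * exp (y t)) t ∧
      HasDerivAt y (A / p * (exp (x t) - 1) + μ t * θ * exp (y t) / p) t := fun t ht => by
    obtain ⟨⟨⟨hFd, hFpos⟩, -⟩, -, hpos, -⟩ := hU₁ _ (hUt t ht)
    refine hasDerivAt_lotkaVolterra_coords hA hθ hp hα hγ (m := m) ?_ ?_ (hmpos t ht)
      (((hf.contDiffAt (Ici_mem_nhds hpos)).differentiableAt (by norm_num)).hasDerivAt) hFd hFpos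
      hx hy (congrFun hμ t)
    · rw [hm]; exact hasDerivAt_integral_rpow_mul_exp hγ1 hφ (hmem t ht)
    · rw [hm]; exact hasDerivAt_regular_solution hp hθ hκ hγ hα' hφ hv (hmem t ht)
  have hsum : ∀ t ∈ Icc 0 T, x t + p * y t =
      p * log (K * exp (ℓ + t) ^ (θ / p) / F (v (exp (ℓ + t)))) := fun t ht => by
    rw [hx, hy, hK]
    exact lotkaVolterra_coords_add hA hθ hp (hU₁ _ (hUt t ht)).1.1.2
  have h0 : (0 : ℝ) ∈ Icc 0 T := ⟨le_rfl, hT.le⟩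
  have hw : ∀ s ∈ Icc 0 (exp (ℓ + 0)), v s ∈ Icc (ρ - D / 2 / deriv f ρ) ρ := fun s hs => by
    have := hvw 0 (by linarith) s hs
    rwa [zero_mul, exp_zero, mul_one] at this
  have hfw : ∀ s ∈ Icc 0 (exp (ℓ + 0)), f ρ - D ≤ f (v s) ∧ f (v s) ≤ f ρ := fun s hs => by
    obtain ⟨h1, h2, -⟩ := hw₀ (v s) (hw s hs)
    have h3 : 0 ≤ v s := hU₁0.le.trans h1
    exact ⟨by linarith, hmono.monotoneOn h3 hρ.le (hw s hs).2⟩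
  have hr0 : exp (ℓ + 0) ∈ Icc 0 (exp (ℓ + 0)) := ⟨(exp_pos _).le, le_rfl⟩
  have hlog : ∀ a, log (exp a * (exp (ℓ + 0) ^ (A + θ) / (A + θ))) =
      a + (A + θ) * ℓ - log (A + θ) := fun a => by
    rw [← exp_mul, log_mul (exp_pos _).ne' (by positivity), log_div (exp_pos _).ne' hκ.ne', log_exp,
      log_exp]
    ring
  have hmu : log (m (exp (ℓ + 0))) ≤ f ρ + (A + θ) * ℓ - log (A + θ) := by
    rw [← hlog]
    refine log_le_log (hmpos 0 h0) ?_
    rw [hm]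
    exact integral_rpow_mul_le hκ hγ (exp_pos _).le fun s hs => (hfw s (Ioo_subset_Icc_self hs)).2
  have hml : f ρ - D + (A + θ) * ℓ - log (A + θ) ≤ log (m (exp (ℓ + 0))) := by
    rw [← hlog]
    refine log_le_log (by positivity) ?_
    rw [hm]
    exact le_integral_rpow_mul_exp hκ hγ hφ (Ioo_subset_Icc_self (hmem 0 h0))
      fun s hs => (hfw s (Ioo_subset_Icc_self hs)).1
  obtain ⟨hf1, hf2⟩ := hfw _ hr0
  have hx0 : x 0 = (A + θ) * ℓ + f (v (exp (ℓ + 0))) - log (m (exp (ℓ + 0))) - log A := by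
    rw [hx]; simp only [add_zero]
  have hxl : D ≤ x 0 := by linarith only [hx0, hmu, hf1, hD]
  have hxu : x 0 ≤ 3 * D := by linarith only [hx0, hml, hf2, hD]
  have hz0 : |x 0 + p * y 0| ≤ Z := by
    obtain ⟨⟨⟨-, hFpos⟩, -⟩, ⟨hQ1, hQ2⟩, hpos, -⟩ := hU₁ _ (hUt 0 h0)
    obtain ⟨-, -, h3, h4⟩ := hw₀ _ (hw _ hr0)
    rw [hsum 0 h0, hpow, zero_mul, exp_zero, mul_one, ← mul_assoc, abs_mul, abs_of_pos hp, hZ, hhdef]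
    gcongr
    exact abs_log_le_of_mem_Icc (by positivity) (mul_div_mem_Icc_of_window (by positivity) hp hρ'
      (hf' _ hpos.le) hFpos hf1 hf2 h3 h4 hQ1 hQ2)
  have hy0 : |y 0| ≤ (Z + 3 * D) / p := by
    have e : |y 0| * p = |y 0 * p| := by rw [abs_mul, abs_of_pos hp]
    rw [le_div_iff₀ hp, e]
    obtain ⟨h1, h2⟩ := abs_le.1 hz0
    exact abs_le.2 ⟨by linarith only [h1, h2, hxl, hxu, hD0], by linarith only [h1, h2, hxl, hxu, hD0]⟩
  have hnn : 0 ≤ (Z + 3 * D) / p := by positivity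
  obtain ⟨τ, hτ, hτ'⟩ := hdyn x y μ (fun t ht => (hode t ht).1) (fun t ht => (hode t ht).2)
    (fun t ht => by
      obtain ⟨⟨-, hη1, hη2⟩, -⟩ := hU₁ _ (hUt t ht)
      rw [hμ, abs_le]
      exact ⟨by linarith only [hη1], by linarith only [hη2]⟩)
    hxl (by linarith only [hxu, hnn]) (by linarith only [hy0, hD0])
  refine ⟨fun k => exp (ℓ + τ k), fun i j hij => exp_lt_exp.2 (by linarith [hτ hij]),
    fun k hk => ?_⟩
  obtain ⟨h1, h2⟩ := hτ' k hk
  rw [hsum _ h1, hK] at h2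
  exact ⟨⟨exp_pos _, (hmem _ h1).2.trans hRmR⟩,
    (hU₁ _ le_rfl).2.2.2.trans (hUt _ h1), h2⟩

theorem integral_Ici_le_of_le {φ : ℝ → ℝ} {U a b : ℝ} (hφ : IntegrableOn φ (Ioi U))
    (hpos : ∀ s, 0 < φ s) (ha : U < a) (hab : a ≤ b) : ∫ s in Ici b, φ s ≤ ∫ s in Ici a, φ s :=
  setIntegral_mono_set (hφ.mono_set (Ici_subset_Ioi.2 ha)) (Eventually.of_forall fun s => (hpos s).le)
    (Ici_subset_Ici.2 hab).eventuallyLE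

/-- If `|p log (1 + δ)| < d` and `p log (X / F₁)` has the sign of `(-1) ^ k` and size at least `d`,
then an antitone `F` with `F w = X (1 + δ)` and `F v = F₁` separates `v` from `w` accordingly. -/
theorem neg_one_pow_mul_sub_pos_of_log {F : ℝ → ℝ} {p d X δ v w : ℝ} {k : ℕ} {s : Set ℝ}
    (hF : AntitoneOn F s) (hv : v ∈ s) (hw : w ∈ s) (hp : 0 < p) (hX : 0 < X) (hδ : 0 < 1 + δ)
    (hδ' : |p * log (1 + δ)| < d) (hFv : 0 < F v) (hFw : F w = X * (1 + δ))
    (h : d ≤ (-1) ^ k * (p * log (X / F v))) : 0 < (-1) ^ k * (v - w) := by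
  obtain ⟨h1, h2⟩ := abs_lt.1 hδ'
  have hFw' : 0 < F w := by rw [hFw]; positivity
  have e : p * log (X / F v) = p * log (F w) - p * log (F v) - p * log (1 + δ) := by
    rw [hFw, log_div hX.ne' hFv.ne', log_mul hX.ne' hδ.ne']; ring
  rw [e] at h
  rcases neg_one_pow_eq_or ℝ k with hk | hk <;> rw [hk] at h ⊢
  · by_contra! hc
    have := mul_le_mul_of_nonneg_left
      (log_le_log hFw' (hF hv hw (by linarith only [hc]))) hp.le
    linarith only [this, h, h1]
  · by_contra! hc
    have := mul_le_mul_of_nonneg_left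
      (log_le_log hFv (hF hw hv (by linarith only [hc]))) hp.le
    linarith only [this, h, h2]

/-- Theorem 1.3 / 4.2: under (A1)–(A6) and α − β − 1 < 4θ/(β+1), the number of
intersection points of the regular solution u(·,ρ) with the singular solution u*
on (0,δ') tends to +∞ as ρ → +∞. -/
theorem stmt_3 (α β γ θ : ℝ) (hθ : θ = γ + 2 + β - α) (f g : ℝ → ℝ)
    -- (A1): f is C⁴ on [0,∞), increasing, tending to +∞; g is its inverse
    (hf : ContDiffOn ℝ 4 f (Ici 0))
    (hf' : ∀ u ∈ Ici (0:ℝ), 0 < deriv f u)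
    (hftop : Tendsto f atTop atTop)
    (hgf : ∀ u ∈ Ici (0:ℝ), g (f u) = u)
    (hfg : ∀ t ∈ Ici (f 0), f (g t) = t)
    -- (A2)
    (hA2a : Tendsto (fun t => deriv (deriv g) t) atTop (nhds 0))
    (hA2b : ∀ ε : ℝ → ℝ, (ε =O[atTop] fun t => deriv (deriv g) t) →
      Tendsto (fun t => f (g t + ε t) / t) atTop (nhds 1))
    -- (A3)
    (hA3 : ∀ h : ℝ → ℝ, (h =o[atTop] fun t : ℝ => t) →
      Tendsto (fun t => deriv g t / deriv g (t + h t)) atTop (nhds 1))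
    -- (A4)
    (hA4 : Tendsto (fun t => deriv (deriv g) t / deriv g t * Real.log (deriv g t))
      atTop (nhds 0))
    -- (A5)
    (hA5a : ∀ n : ℕ, n ≤ 2 →
      (fun t => deriv (deriv (deriv g)) t * Real.log (deriv g t) ^ n)
        =O[atTop] fun t => deriv (deriv g) t)
    (hA5b : (fun t => deriv (deriv (deriv (deriv g))) t * Real.log (deriv g t))
        =O[atTop] fun t => deriv (deriv g) t)
    (hA5c : ∃ C : ℝ, ∀ᶠ t in atTop, ∀ s, t ≤ s →
      |deriv (deriv g) s| ≤ C * |deriv (deriv g) t|)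
    (hA5d : ∀ h : ℝ → ℝ, (h =o[atTop] fun t : ℝ => t) →
      (fun t => deriv (deriv g) (t + h t)) =O[atTop] fun t => deriv (deriv g) t)
    -- (A6)
    (hαβ : α > β + 1) (hβ : 0 ≤ β) (hθpos : 0 < θ)
    (hcond : α - β - 1 < 4 * θ / (β + 1))
    -- the family of regular solutions of L(u) + e^{f(u)} = 0, u(0,ρ)=ρ, ∂_r u(0,ρ)=0,
    -- given as the unique continuous solution of the integral equation
    (u : ℝ → ℝ → ℝ)
    (hucont : ∀ ρ, 0 < ρ → ContinuousOn (u ρ) (Ici 0))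
    (hueq : ∀ ρ, 0 < ρ → ∀ r, 0 ≤ r →
      u ρ r = ρ - ∫ t in (0:ℝ)..r, t ^ (-(α / (β + 1))) *
        (∫ s in (0:ℝ)..t, s ^ γ * Real.exp (f (u ρ s))) ^ ((1:ℝ) / (β + 1)))
    -- u* : a C², strictly decreasing singular solution on (0,∞) with the stated
    -- representation F(u*(r)) = K r^{θ/(β+1)} (1 + δ(r)), δ(r) → 0 as r → 0+
    (ustar δ : ℝ → ℝ)
    (hstarC2 : ContDiffOn ℝ 2 ustar (Ioi 0))
    (hstarAnti : StrictAntiOn ustar (Ioi 0))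
    (hstarODE : ∀ r, 0 < r →
      HasDerivAt (fun x : ℝ => x ^ α * |deriv ustar x| ^ β * deriv ustar x)
        (-(r ^ γ * Real.exp (f (ustar r)))) r)
    (hstarBlow : Tendsto ustar (nhdsWithin 0 (Ioi 0)) atTop)
    (hδ : Tendsto δ (nhdsWithin 0 (Ioi 0)) (nhds 0))
    (hrep : ∀ r, 0 < r →
      (∫ s in Ici (ustar r), Real.exp (-f s / (β + 1))) =
        (β + 1) / θ * (α - β - 1) ^ (-((1:ℝ) / (β + 1))) * r ^ (θ / (β + 1)) * (1 + δ r))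
    : ∀ δ' : ℝ, 0 < δ' → ∀ N : ℕ, ∃ ρ₀ : ℝ, ∀ ρ, ρ₀ ≤ ρ →
      ∃ t : Finset ℝ, t.card = N ∧ ∀ x ∈ t, x ∈ Ioo 0 δ' ∧ u ρ x = ustar x := by
  have hf2 : ContDiffOn ℝ 2 f (Ici 0) := hf.of_le (by norm_num)
  have hp : 0 < β + 1 := by linarith
  have hA : 0 < α - β - 1 := by linarith
  have hgpos : ∀ᶠ t in atTop, 0 < deriv g t :=
    eventually_of_forall_comp hf.continuousOn hftop fun v hv => by
      rw [(hasDerivAt_inverse_of_leftInvOn hf2 hf' hgf hv).deriv]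
      exact inv_pos.2 (hf' v hv.le)
  have hκ := tendsto_logDeriv_of_tendsto_mul_log hgpos hA2a hA4
  obtain ⟨U₀, hU₀, hint⟩ := integrableOn_exp_neg_div hf2 hf' hftop hgf hκ hp
  obtain ⟨F, hFdef⟩ : ∃ F : ℝ → ℝ, F = fun v => ∫ s in Ici v, exp (-f s / (β + 1)) := ⟨_, rfl⟩
  have hFpos : ∀ v ∈ Ioi U₀, 0 < F v := fun v hv => by
    rw [hFdef]; exact integral_Ici_pos hint (fun s => exp_pos _) hv
  have hFanti : AntitoneOn F (Ioi U₀) := fun a ha b _ hab => by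
    rw [hFdef]; exact integral_Ici_le_of_le hint (fun s => exp_pos _) ha hab
  have hcont : ContinuousOn (fun v => exp (-f v / (β + 1))) (Ioi U₀) :=
    ((hf.continuousOn.mono fun v hv => hU₀.le.trans (le_of_lt hv)).neg.div_const _).rexp
  have hFder : ∀ᶠ v in atTop, HasDerivAt F (-exp (-f v / (β + 1))) v ∧ 0 < F v := by
    filter_upwards [eventually_gt_atTop U₀] with v hv
    refine ⟨?_, hFpos v hv⟩
    rw [hFdef]
    exact hasDerivAt_integral_Ici hint hcont hv
  have hQ := tendsto_integral_mul_deriv_mul_exp hf2 hf' hftop hgf hκ hp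
  have hh : Tendsto (fun v => exp (-f v / (β + 1)) / deriv f v) atTop (nhds 0) := by
    refine (tendsto_exp_div_deriv hf2 hf' hftop hgf hκ hp).congr' ?_
    filter_upwards [eventually_gt_atTop 0] with v hv
    rw [(hasDerivAt_inverse_of_leftInvOn hf2 hf' hgf hv).deriv, ← div_eq_mul_inv]
  intro δ' hδ' N
  obtain ⟨d, hd, hosc⟩ := exists_alternating_regular_solution (α := α) (γ := γ) hA hθpos hp
    (by ring) (by rw [hθ]; ring) hcond hf2 hf' hFder (by rw [hFdef]; exact hQ)
    (fun S hS U => eventually_forall_window hf2 hf' hftop hgf hA3 hS U) hh N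
  have hδlog : ∀ᶠ r in nhdsWithin 0 (Ioi 0), |(β + 1) * log (1 + δ r)| < d := by
    have h1 : Tendsto (fun r => 1 + δ r) (nhdsWithin 0 (Ioi 0)) (nhds 1) := by
      simpa using hδ.const_add 1
    have h2 := ((h1.log one_ne_zero).const_mul (β + 1)).abs
    rw [log_one, mul_zero, abs_zero] at h2
    exact h2.eventually (gt_mem_nhds hd)
  have hδpos : ∀ᶠ r in nhdsWithin 0 (Ioi 0), 0 < 1 + δ r := by
    filter_upwards [hδ.eventually (lt_mem_nhds (by norm_num : (-1 : ℝ) < 0))] with r hr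
    linarith
  obtain ⟨R₀, hR₀, hsmall⟩ := mem_nhdsGT_iff_exists_Ioo_subset.1
    (hδlog.and (hδpos.and (hstarBlow.eventually (eventually_gt_atTop U₀))))
  have hR₀' : (0 : ℝ) < R₀ := hR₀
  obtain ⟨ρ₀, hρ₀⟩ := eventually_atTop.1
    ((hosc (U₀ + 1) (min R₀ δ') (lt_min hR₀' hδ')).and (eventually_gt_atTop 0))
  refine ⟨ρ₀, fun ρ hρ => ?_⟩
  obtain ⟨hsol, hρpos⟩ := hρ₀ ρ hρ
  obtain ⟨σ, hσ, hσ'⟩ := hsol (u ρ) (hucont ρ hρpos) (hueq ρ hρpos)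
  have hcontφ : ContinuousOn (fun r => u ρ r - ustar r) (Ioo 0 (min R₀ δ')) :=
    ((hucont ρ hρpos).mono fun r hr => hr.1.le).sub
      (hstarC2.continuousOn.mono fun r hr => hr.1)
  obtain ⟨t, ht, ht'⟩ := exists_finset_zeros_of_alternating N hcontφ hσ fun k hk => by
    obtain ⟨hmem, hU, hlog⟩ := hσ' k hk
    obtain ⟨h1, h2, h3⟩ := hsmall ⟨hmem.1, hmem.2.trans_le (min_le_left _ _)⟩
    have hr := hmem.1
    have hv : u ρ (σ k) ∈ Ioi U₀ := lt_of_lt_of_le (by linarith) hU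
    exact ⟨hmem, neg_one_pow_mul_sub_pos_of_log hFanti hv h3 hp (by positivity) h2 h1 (hFpos _ hv)
      (by rw [hFdef]; exact hrep _ hr) hlog⟩
  exact ⟨t, ht, fun r hr => ⟨⟨(ht' r hr).1.1, (ht' r hr).1.2.trans_le (min_le_right _ _)⟩,
    sub_eq_zero.1 (ht' r hr).2⟩⟩
end

section
/- Assume α > β+1, β ≥ 0, θ := γ + 2 + β − α > 0 and α − β − 1 ≥ 4θ(β+1). Let ρ ∈ ℝ and let u be the regular solution of L(u) + e^{u} = 0 on [0,∞) with u(0) = ρ and u'(0) = 0, and let u*(s) = ln(θ^{β+1}(α−β−1)) − θ ln s. Then u(s) ≠ u*(s) for every s > 0, i.e. the regular and singular solutions do not intersect. -/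
open Filter Set Real

/-- Autonomous system satisfied, in the variable `log r`, by the difference `v` of the regular and
singular solutions and by `Y = -r u' / θ`: the line `Y = 1 + 2 v` is a barrier keeping `v`
negative. -/
lemma neg_of_emden_system {θ k p : ℝ} (hθ : 0 < θ) (hp : 1 ≤ p) (hk : 4 * θ ≤ k)
    {v Y : ℝ → ℝ} (hY : ∀ r, 0 < r → 0 < Y r)
    (hv' : ∀ r, 0 < r → HasDerivAt v (θ * (1 - Y r) / r) r)
    (hY' : ∀ r, 0 < r → HasDerivAt Y (k * (Real.exp (v r) * Y r ^ (1 - p) - Y r) / r) r)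
    (hv : Tendsto v (nhdsWithin 0 (Ioi 0)) atBot) {r : ℝ} (hr : 0 < r) : v r < 0 := by
  by_contra! hvr
  obtain ⟨δ, hδv, hδ0, hδr⟩ : ∃ δ, v δ < -1 ∧ 0 < δ ∧ δ < r := by
    have h1 := hv.eventually (eventually_lt_atBot (-1 : ℝ))
    have h2 : ∀ᶠ x in nhdsWithin (0 : ℝ) (Ioi 0), x ∈ Ioo 0 r := Ioo_mem_nhdsGT hr
    obtain ⟨δ, h3, h4⟩ := (h1.and h2).exists
    exact ⟨δ, h3, h4.1, h4.2⟩
  have hvc : ContinuousOn v (Icc δ r) := fun x hx =>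
    (hv' x (hδ0.trans_le hx.1)).continuousAt.continuousWithinAt
  have hcomp : IsCompact (Icc δ r ∩ v ⁻¹' Ici 0) :=
    isCompact_Icc.of_isClosed_subset
      (hvc.preimage_isClosed_of_isClosed isClosed_Icc isClosed_Ici) inter_subset_left
  obtain ⟨s, ⟨⟨hδs, hsr⟩, hvs⟩, hmin⟩ :=
    hcomp.exists_isLeast ⟨r, ⟨hδr.le, le_rfl⟩, hvr⟩
  have hneg : ∀ x ∈ Ico δ s, v x < 0 := by
    intro x hx
    by_contra! h
    exact absurd (hmin ⟨⟨hx.1, hx.2.le.trans hsr⟩, h⟩) (not_le.2 hx.2)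
  have hbar : ∀ ⦃x⦄, x ∈ Icc δ s → 1 + 2 * v x ≤ Y x := by
    have hpos : ∀ x, x ∈ Icc δ s → 0 < x := fun x hx => hδ0.trans_le hx.1
    refine image_le_of_deriv_right_lt_deriv_boundary' (f := fun x => 1 + 2 * v x)
      (f' := fun x => 2 * (θ * (1 - Y x) / x))
      (B' := fun x => k * (Real.exp (v x) * Y x ^ (1 - p) - Y x) / x) ?_ ?_ ?_ ?_ ?_ ?_
    · intro x hx
      exact (((hv' x (hpos x hx)).const_mul 2).const_add 1).continuousAt.continuousWithinAt
    · intro x hx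
      exact (((hv' x (hpos x ⟨hx.1, hx.2.le⟩)).const_mul 2).const_add 1).hasDerivWithinAt
    · have := hY δ hδ0
      linarith
    · intro x hx
      exact (hY' x (hpos x hx)).continuousAt.continuousWithinAt
    · intro x hx
      exact (hY' x (hpos x ⟨hx.1, hx.2.le⟩)).hasDerivWithinAt
    · intro x hx hxY
      have hx0 := hpos x ⟨hx.1, hx.2.le⟩
      have hvx := hneg x hx
      have hexp := Real.add_one_lt_exp hvx.ne
      have hpow : 1 ≤ Y x ^ (1 - p) :=
        Real.one_le_rpow_of_pos_of_le_one_of_nonpos (hY x hx0) (by linarith) (by linarith)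
      have hmul : v x + 1 < Real.exp (v x) * Y x ^ (1 - p) := by
        nlinarith [Real.exp_pos (v x)]
      have hk0 : 0 < k := by linarith
      rw [← mul_div_assoc, div_lt_div_iff_of_pos_right hx0]
      have h1 : k * (v x + 1 - Y x) < k * (Real.exp (v x) * Y x ^ (1 - p) - Y x) := by
        gcongr
      have h2 : 0 ≤ (k - 4 * θ) * (- v x) := mul_nonneg (by linarith) (by linarith)
      have h3 : Y x = 1 + 2 * v x := hxY.symm
      rw [h3] at h1 ⊢
      nlinarith
  have hanti : AntitoneOn (fun x => v x * x ^ (2 * θ)) (Icc δ s) := by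
    have hd : ∀ x, 0 < x → HasDerivAt (fun x => v x * x ^ (2 * θ))
        (θ * (1 - Y x) / x * x ^ (2 * θ) + v x * (2 * θ * x ^ (2 * θ - 1))) x := fun x hx =>
      (hv' x hx).mul (Real.hasDerivAt_rpow_const (Or.inl hx.ne'))
    refine antitoneOn_of_deriv_nonpos (convex_Icc δ s)
      (fun x hx => (hd x (hδ0.trans_le hx.1)).continuousAt.continuousWithinAt) ?_ ?_
    · rw [interior_Icc]
      exact fun x hx => (hd x (hδ0.trans hx.1)).differentiableAt.differentiableWithinAt
    · rw [interior_Icc]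
      intro x hx
      have hx0 := hδ0.trans hx.1
      rw [(hd x hx0).deriv, Real.rpow_sub_one hx0.ne']
      have hb := hbar ⟨hx.1.le, hx.2.le⟩
      have : θ * (1 - Y x) / x * x ^ (2 * θ) + v x * (2 * θ * (x ^ (2 * θ) / x))
          = -(θ * (x ^ (2 * θ) / x) * (Y x - (1 + 2 * v x))) := by ring
      rw [this, neg_nonpos]
      have := sub_nonneg.2 hb
      positivity
  have hle := hanti ⟨le_rfl, hδs⟩ ⟨hδs, le_rfl⟩ hδs
  have h1 : v δ * δ ^ (2 * θ) < 0 :=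
    mul_neg_of_neg_of_pos (by linarith) (Real.rpow_pos_of_pos hδ0 _)
  have h2 : 0 ≤ v s * s ^ (2 * θ) :=
    mul_nonneg hvs (Real.rpow_nonneg (hδ0.le.trans hδs) _)
  exact absurd (hle.trans_lt h1) (not_lt.2 h2)

lemma hasDerivAt_integral_of_continuousOn_Ioi {f : ℝ → ℝ} (hf : ContinuousOn f (Ioi 0)) {r : ℝ}
    (hr : 0 < r) (hint : IntervalIntegrable f MeasureTheory.volume 0 r) :
    HasDerivAt (fun t => ∫ s in (0 : ℝ)..t, f s) (f r) r :=
  intervalIntegral.integral_hasDerivAt_right hint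
    (hf.stronglyMeasurableAtFilter isOpen_Ioi r hr) (hf.continuousAt (Ioi_mem_nhds hr))

lemma continuousOn_rpow_mul_exp {γ : ℝ} {u : ℝ → ℝ} (hu : ContinuousOn u (Ici 0)) :
    ContinuousOn (fun s => s ^ γ * Real.exp (u s)) (Ioi 0) :=
  (continuousOn_id.rpow_const fun _ hx => Or.inl (ne_of_gt hx)).mul
    (hu.mono Ioi_subset_Ici_self).rexp

lemma intervalIntegrable_rpow_mul_exp_s6 {γ : ℝ} (hγ : -1 < γ) {u : ℝ → ℝ}
    (hu : ContinuousOn u (Ici 0)) {r : ℝ} (hr : 0 ≤ r) :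
    IntervalIntegrable (fun s => s ^ γ * Real.exp (u s)) MeasureTheory.volume 0 r := by
  refine (intervalIntegral.intervalIntegrable_rpow' hγ).mul_continuousOn ?_
  rw [uIcc_of_le hr]
  exact (hu.mono fun x hx => hx.1).rexp

lemma intervalIntegrable_regular_slope {α γ p : ℝ} (hp : 0 < p) (hγ : -1 < γ)
    (hθ : 0 < γ + 1 + p - α) {u : ℝ → ℝ} (hu : ContinuousOn u (Ici 0))
    (hG : ContinuousOn (fun t => t ^ (-(α / p)) *
      (∫ s in (0 : ℝ)..t, s ^ γ * Real.exp (u s)) ^ (1 / p)) (Ioi 0)) {r : ℝ} (hr : 0 < r) :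
    IntervalIntegrable (fun t => t ^ (-(α / p)) *
      (∫ s in (0 : ℝ)..t, s ^ γ * Real.exp (u s)) ^ (1 / p)) MeasureTheory.volume 0 r := by
  obtain ⟨M, hM⟩ := (isCompact_Icc (a := (0 : ℝ)) (b := r)).bddAbove_image
    (hu.mono fun x hx => hx.1)
  have hbound : ∀ t ∈ Ioc 0 r, ∫ s in (0 : ℝ)..t, s ^ γ * Real.exp (u s)
      ≤ Real.exp M / (γ + 1) * t ^ (γ + 1) := by
    intro t ht
    calc ∫ s in (0 : ℝ)..t, s ^ γ * Real.exp (u s)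
        ≤ ∫ s in (0 : ℝ)..t, s ^ γ * Real.exp M := by
          refine intervalIntegral.integral_mono_on ht.1.le
            (intervalIntegrable_rpow_mul_exp_s6 hγ hu ht.1.le)
            ((intervalIntegral.intervalIntegrable_rpow' hγ).mul_const _) fun s hs => ?_
          have := Real.rpow_nonneg hs.1 γ
          gcongr
          exact hM ⟨s, ⟨hs.1, hs.2.trans ht.2⟩, rfl⟩
      _ = _ := by
          rw [intervalIntegral.integral_mul_const, integral_rpow (Or.inl hγ),
            Real.zero_rpow (by linarith)]
          ring
  have hdom : IntervalIntegrable
      (fun t => (Real.exp M / (γ + 1)) ^ (1 / p) * t ^ ((γ + 1 - α) / p))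
      MeasureTheory.volume 0 r := by
    refine (intervalIntegral.intervalIntegrable_rpow' ?_).const_mul _
    rw [lt_div_iff₀ hp]
    linarith
  refine hdom.mono_fun' ?_ ?_
  · rw [uIoc_of_le hr.le]
    exact (hG.mono fun x hx => hx.1).aestronglyMeasurable measurableSet_Ioc
  · rw [uIoc_of_le hr.le]
    refine (MeasureTheory.ae_restrict_iff' measurableSet_Ioc).2 (Eventually.of_forall ?_)
    intro t ht
    have ht0 : 0 < t := ht.1
    have hI0 : 0 ≤ ∫ s in (0 : ℝ)..t, s ^ γ * Real.exp (u s) :=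
      intervalIntegral.integral_nonneg ht0.le fun s hs =>
        mul_nonneg (Real.rpow_nonneg hs.1 _) (Real.exp_pos _).le
    have hγ1 : 0 < γ + 1 := by linarith
    dsimp only
    rw [Real.norm_of_nonneg (by positivity)]
    calc _ ≤ t ^ (-(α / p)) * (Real.exp M / (γ + 1) * t ^ (γ + 1)) ^ (1 / p) := by
          gcongr
          exact hbound t ht
      _ = _ := by
          rw [Real.mul_rpow (by positivity) (by positivity), ← Real.rpow_mul ht0.le,
            mul_left_comm, ← Real.rpow_add ht0]
          congr 2
          ring

/-- Theorem 1.6 / 5.2: for `L(u) + e^u = 0` with `α − β − 1 ≥ 4θ(β+1)`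
(i.e. `d ≥ 2k + 8k²`), the regular solution `u` (with `u(0) = ρ`, `u'(0) = 0`,
given by its integral equation) never intersects the singular solution
`u*(s) = ln(θ^{β+1}(α−β−1)) − θ ln s` on `(0, ∞)`. -/
theorem stmt_6 (α β γ θ : ℝ) (hθ : θ = γ + 2 + β - α)
    (hαβ : α > β + 1) (hβ : 0 ≤ β) (hθpos : 0 < θ)
    (hcond : 4 * θ * (β + 1) ≤ α - β - 1)
    (ρ : ℝ) (u : ℝ → ℝ) (hu : ContinuousOn u (Ici 0))
    (hueq : ∀ r, 0 ≤ r →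
      u r = ρ - ∫ t in (0:ℝ)..r, t ^ (-(α / (β + 1))) *
        (∫ s in (0:ℝ)..t, s ^ γ * Real.exp (u s)) ^ ((1:ℝ) / (β + 1)))
    (ustar : ℝ → ℝ)
    (hustar : ∀ s, ustar s = Real.log (θ ^ (β + 1) * (α - β - 1)) - θ * Real.log s) :
    ∀ s, 0 < s → u s ≠ ustar s := by
  set p := β + 1 with hp
  have hp0 : 0 < p := by linarith
  have hap : 0 < α - p := by linarith
  have hγ : -1 < γ := by linarith
  set I : ℝ → ℝ := fun t => ∫ s in (0:ℝ)..t, s ^ γ * Real.exp (u s) with hI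
  have hI' : ∀ r, 0 < r → HasDerivAt I (r ^ γ * Real.exp (u r)) r := fun r hr =>
    hasDerivAt_integral_of_continuousOn_Ioi (continuousOn_rpow_mul_exp hu) hr
      (intervalIntegrable_rpow_mul_exp_s6 hγ hu hr.le)
  have hIpos : ∀ r, 0 < r → 0 < I r := fun r hr =>
    intervalIntegral.intervalIntegral_pos_of_pos_on (intervalIntegrable_rpow_mul_exp_s6 hγ hu hr.le)
      (fun x hx => mul_pos (Real.rpow_pos_of_pos hx.1 _) (Real.exp_pos _)) hr
  set G : ℝ → ℝ := fun t => t ^ (-(α / p)) * I t ^ ((1:ℝ) / p) with hG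
  have hGc : ContinuousOn G (Ioi 0) := by
    intro x hx
    have hx : 0 < x := hx
    exact ((Real.continuousAt_rpow_const _ _ (Or.inl hx.ne')).mul
      ((hI' x hx).continuousAt.rpow_const (Or.inl (hIpos x hx).ne'))).continuousWithinAt
  have hu' : ∀ r, 0 < r → HasDerivAt u (-G r) r := by
    intro r hr
    have h := (hasDerivAt_integral_of_continuousOn_Ioi hGc hr
      (intervalIntegrable_regular_slope hp0 hγ (by linarith) hu hGc hr)).const_sub ρ
    refine h.congr_of_eventuallyEq ?_
    filter_upwards [Ioi_mem_nhds hr] with x hx using hueq x (le_of_lt hx)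
  have hCpos : 0 < θ ^ p * (α - p) := mul_pos (Real.rpow_pos_of_pos hθpos _) hap
  have hsub : α - β - 1 = α - p := by rw [hp]; ring
  rw [hsub] at hustar hcond
  intro s hs
  refine sub_ne_zero.1 (ne_of_lt ?_)
  refine neg_of_emden_system (v := fun r => u r - ustar r)
    (Y := fun r => r ^ (1 - α / p) * I r ^ (1 / p) / θ) (k := (α - p) / p) (p := p)
    hθpos (by linarith) ?_ ?_ ?_ ?_ ?_ hs
  · rw [le_div_iff₀ hp0]
    exact hcond
  · intro r hr
    have := hIpos r hr
    positivity
  · intro r hr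
    simp only [hustar]
    refine ((hu' r hr).sub (((Real.hasDerivAt_log hr.ne').const_mul θ).const_sub _)).congr_deriv ?_
    have h1 : r ^ (1 - α / p) = r * r ^ (-(α / p)) := by
      rw [sub_eq_add_neg, Real.rpow_add hr, Real.rpow_one]
    simp only [hG]
    rw [h1]
    field_simp
    ring
  · intro r hr
    have hIr := hIpos r hr
    refine (((Real.hasDerivAt_rpow_const (p := 1 - α / p) (Or.inl hr.ne')).mul
      ((hI' r hr).rpow_const (p := 1 / p) (Or.inl hIr.ne'))).div_const θ).congr_deriv ?_
    have hexp : Real.exp (u r - ustar r) = Real.exp (u r) * r ^ θ / (θ ^ p * (α - p)) := by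
      rw [hustar, sub_sub_eq_add_sub, Real.exp_sub, Real.exp_add, Real.exp_log hCpos,
        Real.rpow_def_of_pos hr, mul_comm θ]
    have hYp : (r ^ (1 - α / p) * I r ^ (1 / p) / θ) ^ (1 - p)
        = r ^ ((1 - α / p) * (1 - p)) * I r ^ (1 / p - 1) * θ ^ p / θ := by
      rw [Real.div_rpow (by positivity) hθpos.le, Real.mul_rpow (by positivity) (by positivity),
        ← Real.rpow_mul hr.le, ← Real.rpow_mul hIr.le, Real.rpow_sub hθpos, Real.rpow_one]
      have : 1 / p * (1 - p) = 1 / p - 1 := by field_simp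
      rw [this]
      field_simp
    have hr' : r ^ θ * r ^ ((1 - α / p) * (1 - p)) = r ^ (1 - α / p) * r ^ γ * r := by
      nth_rewrite 5 [← Real.rpow_one r]
      rw [← Real.rpow_add hr, ← Real.rpow_add hr, ← Real.rpow_add hr]
      congr 1
      rw [hθ]
      field_simp
      rw [hp]
      ring
    rw [hexp, hYp, Real.rpow_sub_one hr.ne']
    have hprod : Real.exp (u r) * r ^ θ / (θ ^ p * (α - p)) *
        (r ^ ((1 - α / p) * (1 - p)) * I r ^ (1 / p - 1) * θ ^ p / θ)
        = Real.exp (u r) * I r ^ (1 / p - 1) * (r ^ (1 - α / p) * r ^ γ * r) /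
          ((α - p) * θ) := by
      rw [← hr']
      have := (Real.rpow_pos_of_pos hθpos p).ne'
      field_simp
    rw [hprod]
    field_simp
    ring
  · have h0 : Tendsto u (nhdsWithin 0 (Ioi 0)) (nhds (u 0)) :=
      (hu 0 self_mem_Ici).mono_left (nhdsWithin_mono _ Ioi_subset_Ici_self)
    have h1 : Tendsto (fun r => θ * Real.log r) (nhdsWithin 0 (Ioi 0)) atBot :=
      Real.tendsto_log_nhdsGT_zero.const_mul_atBot hθpos
    refine ((h0.sub_const (Real.log (θ ^ p * (α - p)))).add_atBot h1).congr fun r => ?_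
    rw [hustar]
    ring
end
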